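/- arXiv:2208.10667 — 6 statements merged into one kernel-verified Lean document; each statement's English description precedes it below -/
import Mathlib

section
/- Let 𝒳 and 𝒴 be standard Borel spaces, G a countable group acting measurably on 𝒳, f : 𝒳 → 𝒴 a measurable map, and ν a probability measure on 𝒳 such that for every π ∈ G one has f(π·x) = f(x) for ν-almost all x ∈ 𝒳. Then there exists a measurable function f̃ : 𝒳 → 𝒴 that is G-invariant (f̃(π·x) = f̃(x) for all π ∈ G and all x ∈ 𝒳) and satisfies f̃(x) = f(x) for ν-almost all x ∈ 𝒳. -/
open MeasureTheory

/-- Modification lemma: an almost-surely `G`-invariant measurable map into a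
standard Borel space admits a pointwise `G`-invariant measurable modification. -/
theorem invariant_modification
    {X : Type} [MeasurableSpace X] [StandardBorelSpace X]
    {Y : Type} [MeasurableSpace Y] [StandardBorelSpace Y]
    {G : Type} [Group G] [Countable G] [MulAction G X]
    (hact : ∀ g : G, Measurable (fun x : X => g • x))
    (f : X → Y) (hf : Measurable f)
    (ν : Measure X) [IsProbabilityMeasure ν]
    (hinv : ∀ g : G, ∀ᵐ x ∂ν, f (g • x) = f x) :
    ∃ ftilde : X → Y, Measurable ftilde ∧
      (∀ (g : G) (x : X), ftilde (g • x) = ftilde x) ∧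
      (∀ᵐ x ∂ν, ftilde x = f x) := by
  classical
  obtain ⟨x₀⟩ : Nonempty X := nonempty_of_isProbabilityMeasure ν
  set A : Set X := {x | ∀ g : G, f (g • x) = f x} with hA
  have hA_meas : MeasurableSet A := by
    rw [hA, Set.ofPred_forall]
    exact MeasurableSet.iInter fun g => measurableSet_eq_fun (hf.comp (hact g)) hf
  have smul_mem (g : G) {x : X} (hx : x ∈ A) : g • x ∈ A := fun h => by
    rw [smul_smul, hx, hx]
  have smul_mem_iff (g : G) (x : X) : g • x ∈ A ↔ x ∈ A :=
    ⟨fun h => by simpa using smul_mem g⁻¹ h, smul_mem g⟩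
  refine ⟨A.piecewise f fun _ => f x₀, hf.piecewise hA_meas measurable_const,
    fun g x => ?_, ?_⟩
  · by_cases hx : x ∈ A
    · rw [Set.piecewise_eq_of_mem _ _ _ hx, Set.piecewise_eq_of_mem _ _ _ (smul_mem g hx), hx g]
    · rw [Set.piecewise_eq_of_notMem _ _ _ hx,
        Set.piecewise_eq_of_notMem _ _ _ ((smul_mem_iff g x).not.mpr hx)]
  · filter_upwards [ae_all_iff.mpr hinv] with x hx
    exact Set.piecewise_eq_of_mem _ _ _ hx
end

section
/- There is no natural isomorphism between the set-system data structure and the array data structure over {0,1} indexed by subsets; precisely: there exists no family of bijections (e_a), indexed by the finite subsets a ⊆ ℕ, with e_a : 2^{2^a} → {0,1}^{2^a}, such that for every injection τ : b → a between finite subsets of ℕ and every x ⊆ 2^a one has e_b( {τ^{-1}(a') : a' ∈ x} ) = e_a(x) ∘ im(τ), where im(τ) : 2^b → 2^a sends b' ⊆ b to τ(b') ⊆ a. -/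
theorem Set.image_eq_univ_of_nonempty {α β : Type*} [Subsingleton β] (f : α → β)
    {x : Set α} (hx : x.Nonempty) : f '' x = Set.univ :=
  Subsingleton.eq_univ_of_nonempty (hx.image f)

/-- There is no natural isomorphism between the set-system data structure
`a ↦ 2^(2^a)` (with restriction `x ↦ {τ⁻¹(a') : a' ∈ x}`) and the array data
structure `a ↦ {0,1}^(2^a)` (with restriction `y ↦ y ∘ im(τ)`). -/
theorem no_natural_iso_setSystem_array :
    ¬ ∃ e : ∀ a : Finset ℕ, Set (Set ↥a) → (Set ↥a → Bool),
        (∀ a : Finset ℕ, Function.Bijective (e a)) ∧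
        (∀ (b a : Finset ℕ) (τ : ↥b ↪ ↥a) (x : Set (Set ↥a)),
          e b ((fun s : Set ↥a => ⇑τ ⁻¹' s) '' x)
            = fun s : Set ↥b => e a x (⇑τ '' s)) := by
  rintro ⟨e, he, hnat⟩
  -- Three nonempty set systems on a point share their restriction to the empty set,
  -- while only two arrays on a point share a given restriction.
  let a : Finset ℕ := {0}
  let τ : ↥(∅ : Finset ℕ) ↪ ↥a := Function.Embedding.ofIsEmpty
  have at_empty (x : Set (Set ↥a)) (hx : x.Nonempty) :
      e a x ∅ = e ∅ Set.univ ∅ := by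
    have h := congrFun (hnat ∅ a τ x) ∅
    rw [Set.image_eq_univ_of_nonempty _ hx, Set.image_empty] at h
    exact h.symm
  have : Unique ↥a := inferInstanceAs (Unique ↥({0} : Finset ℕ))
  have eq_of_top (x y : Set (Set ↥a)) (hx : x.Nonempty) (hy : y.Nonempty)
      (h : e a x Set.univ = e a y Set.univ) : x = y := by
    refine (he a).injective (funext fun s => ?_)
    rcases s.eq_empty_or_nonempty with rfl | hs
    · rw [at_empty x hx, at_empty y hy]
    · rwa [Subsingleton.eq_univ_of_nonempty hs]
  have hne : (∅ : Set ↥a) ≠ Set.univ := Set.empty_ne_univ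
  have h₁ : ({∅} : Set (Set ↥a)) ≠ {Set.univ} := fun h => hne (Set.singleton_injective h)
  have h₂ : ({∅} : Set (Set ↥a)) ≠ Set.univ := fun h =>
    hne (h.symm ▸ Set.mem_univ Set.univ : Set.univ ∈ ({∅} : Set (Set ↥a))).symm
  have h₃ : ({Set.univ} : Set (Set ↥a)) ≠ Set.univ := fun h =>
    hne (h.symm ▸ Set.mem_univ ∅ : ∅ ∈ ({Set.univ} : Set (Set ↥a)))
  have k₁ := mt (eq_of_top _ _ (Set.singleton_nonempty _) (Set.singleton_nonempty _)) h₁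
  have k₂ := mt (eq_of_top _ _ (Set.singleton_nonempty _) Set.univ_nonempty) h₂
  have k₃ := mt (eq_of_top _ _ (Set.singleton_nonempty _) Set.univ_nonempty) h₃
  exact k₁ ((Bool.eq_not_iff.mpr k₂).trans (Bool.eq_not_iff.mpr k₃).symm)
end

section
/- Let b ⊆ a be finite sets with |b| = k and |a| = n. Then the number of set systems y ⊆ 2^a satisfying {b ∩ a' : a' ∈ y} = {b} equals 2^{2^{n−k}} − 1, whereas for every x ∈ {0,1}^{2^b} the number of arrays y ∈ {0,1}^{2^a} whose restriction y ∘ ι_{2^b,2^a} equals x is 2^{2^n − 2^k}; in particular, for n > k, 2^{2^{n−k}} − 1 ≠ 2^{2^n − 2^k}. -/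
/-- Extending a function along an injection `e` amounts to choosing its values off the range. -/
theorem card_comp_eq_of_injective {X Y B : Type*} [Finite X] [Finite Y]
    {e : X → Y} (he : Function.Injective e) (x : X → B) :
    Nat.card {y : Y → B // y ∘ e = x} = Nat.card B ^ (Nat.card Y - Nat.card X) := by
  classical
  have hbij : Function.Bijective
      (fun (y : {y : Y → B // y ∘ e = x}) (i : ↥(Set.range e)ᶜ) => y.1 i.1) := by
    constructor
    · rintro ⟨y, hy⟩ ⟨z, hz⟩ h
      ext i
      by_cases hi : i ∈ Set.range e
      · obtain ⟨j, rfl⟩ := hi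
        exact congrFun (hy.trans hz.symm) j
      · exact congrFun h ⟨i, hi⟩
    · intro z
      refine ⟨⟨fun i => if h : i ∈ Set.range e then x h.choose else z ⟨i, h⟩, ?_⟩, ?_⟩
      · ext j
        have h : e j ∈ Set.range e := ⟨j, rfl⟩
        simp only [Function.comp_apply, dif_pos h]
        exact congrArg x (he h.choose_spec)
      · ext ⟨i, hi⟩
        exact dif_neg hi
  rw [Nat.card_eq_of_bijective _ hbij, Nat.card_fun, Nat.card_coe_set_eq, Set.ncard_compl,
    ← Nat.card_coe_set_eq, Nat.card_range_of_injective he]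

/-- The sets with image `{z}` are the nonempty subsets of the fiber over `z`. -/
theorem card_image_eq_singleton {X Y : Type*} [Finite X] (g : X → Y) (z : Y) :
    Nat.card {y : Set X // g '' y = {z}} = 2 ^ Nat.card {s : X // g s = z} - 1 := by
  have h : {y : Set X | g '' y = {z}} = 𝒫 {s | g s = z} \ {∅} := by
    ext y
    simp only [Set.mem_ofPred_eq, Set.mem_sdiff, Set.mem_powerset_iff, Set.mem_singleton_iff]
    rw [Set.eq_singleton_iff_nonempty_unique_mem, Set.image_nonempty, Set.forall_mem_image,
      Set.nonempty_iff_ne_empty, and_comm]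
    rfl
  change Nat.card ↥{y : Set X | g '' y = {z}} = 2 ^ Nat.card ↥{s | g s = z} - 1
  rw [h, Nat.card_coe_set_eq, Nat.card_coe_set_eq,
    Set.ncard_sdiff_singleton_of_mem (Set.empty_subset _), Set.ncard_powerset]

theorem two_pow_sub_one_ne_two_pow {p q : ℕ} (hp : p ≠ 0) (hq : q ≠ 0) :
    2 ^ p - 1 ≠ 2 ^ q := by
  obtain ⟨p, rfl⟩ := Nat.exists_eq_succ_of_ne_zero hp
  obtain ⟨q, rfl⟩ := Nat.exists_eq_succ_of_ne_zero hq
  have := Nat.two_pow_pos p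
  simp only [Nat.succ_eq_add_one, pow_succ]
  omega

/-- Fiber-counting identities distinguishing the set-system structure from the
array structure: over a finite set `a` of size `n` with a subset `b` of size `k`,
the set-system restriction to `b` has a fiber over `{b}` of size `2^(2^(n-k)) - 1`,
whereas every fiber of the array restriction has size `2^(2^n - 2^k)`; these
numbers differ for `n > k`. -/
theorem setSystem_array_fiber_counts
    (b a : Finset ℕ) (hba : b ⊆ a) (k n : ℕ) (hb : b.card = k) (ha : a.card = n) :
    (Nat.card {y : Set (Set ↥a) //
        (fun s : Set ↥a => (fun i : ↥b => (⟨i.1, hba i.2⟩ : ↥a)) ⁻¹' s) '' y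
          = {Set.univ}}
      = 2 ^ (2 ^ (n - k)) - 1) ∧
    (∀ x : Set ↥b → Bool,
      Nat.card {y : Set ↥a → Bool //
          (fun s : Set ↥b => y ((fun i : ↥b => (⟨i.1, hba i.2⟩ : ↥a)) '' s)) = x}
        = 2 ^ (2 ^ n - 2 ^ k)) ∧
    (k < n → 2 ^ (2 ^ (n - k)) - 1 ≠ 2 ^ (2 ^ n - 2 ^ k)) := by
  have hinj : Function.Injective (fun i : ↥b => (⟨i.1, hba i.2⟩ : ↥a)) := fun i j h =>
    Subtype.ext (congrArg (fun t : ↥a => t.1) h)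
  have hcb : Nat.card ↥b = k := by simp [hb]
  have hca : Nat.card ↥a = n := by simp [ha]
  have card_set (T : Type) [Finite T] : Nat.card (Set T) = 2 ^ Nat.card T := by
    change Nat.card (T → Prop) = _
    simp [Nat.card_fun]
  refine ⟨?_, fun x => ?_, fun hkn => ?_⟩
  · rw [card_image_eq_singleton]
    have h := card_comp_eq_of_injective hinj (fun _ => True)
    rw [hca, hcb, Nat.card_eq_fintype_card (α := Prop), Fintype.card_prop] at h
    exact congrArg (fun m => 2 ^ m - 1) h
  · have h := card_comp_eq_of_injective (Set.image_injective.2 hinj) x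
    rw [card_set, card_set, hca, hcb, Nat.card_eq_fintype_card (α := Bool), Fintype.card_bool] at h
    exact h
  · have := Nat.pow_lt_pow_right one_lt_two hkn
    exact two_pow_sub_one_ne_two_pow (by positivity) (by omega)
end

section
/- Let D be a Borel data structure over ℕ and 𝒳 a standard Borel space. There is a one-to-one correspondence between natural transformations η : D → ARRAY(𝒳,□*≠) and sequences (f_k)_{k ≥ 0} of measurable maps f_k : D_{[k]} → 𝒳, given as follows: to η associate f_k = η_{[k],(1,…,k)} (the component of η_{[k]} at the index (1,…,k)); conversely, to (f_k) associate the η whose component at a finite set a and index 𝐢 = (i₁,…,i_k) ∈ a*≠ is η_{a,𝐢} = f_k ∘ D[τ_{𝐢,a}], where τ_{𝐢,a} : [k] → a, j ↦ i_j. These two constructions are mutually inverse. -/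
open MeasureTheory ProbabilityTheory

/-- A Borel data structure over `ℕ`: for every finite set `a ⊆ ℕ` a standard Borel
space `obj a`, and contravariantly for every injection `τ : b → a` of finite subsets
of `ℕ` a measurable restriction map `map τ : obj a → obj b`, functorially. -/
structure BDS where
  obj : Finset ℕ → Type
  mss : ∀ a : Finset ℕ, MeasurableSpace (obj a)
  sbs : ∀ a : Finset ℕ, @StandardBorelSpace (obj a) (mss a)
  map : ∀ {b a : Finset ℕ}, (↥b ↪ ↥a) → obj a → obj b
  map_id : ∀ a : Finset ℕ, map (Function.Embedding.refl ↥a) = id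
  map_comp : ∀ {c b a : Finset ℕ} (σ : ↥c ↪ ↥b) (τ : ↥b ↪ ↥a),
    map (σ.trans τ) = map σ ∘ map τ
  map_measurable : ∀ {b a : Finset ℕ} (τ : ↥b ↪ ↥a),
    @Measurable _ _ (mss a) (mss b) (map τ)

attribute [instance] BDS.mss BDS.sbs

/-- The inclusion embedding `↥b ↪ ↥a` associated to `b ⊆ a`. -/
def inclEmb {b a : Finset ℕ} (h : b ⊆ a) : ↥b ↪ ↥a :=
  ⟨fun i => ⟨i.1, h i.2⟩, fun i j hij => by
    rcases i with ⟨i, hi⟩; rcases j with ⟨j, hj⟩; simpa using hij⟩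

/-- An exchangeable law on a Borel data structure: a probability measure on each
`obj a`, compatible with all restriction maps. -/
structure ExchLaw (D : BDS) where
  law : ∀ a : Finset ℕ, Measure (D.obj a)
  prob : ∀ a : Finset ℕ, IsProbabilityMeasure (law a)
  exch : ∀ {b a : Finset ℕ} (τ : ↥b ↪ ↥a), Measure.map (D.map τ) (law a) = law b

/-- A (true) natural transformation of Borel data structures. -/
structure NT (D E : BDS) where
  app : ∀ a : Finset ℕ, D.obj a → E.obj a
  meas : ∀ a : Finset ℕ, Measurable (app a)
  natural : ∀ {b a : Finset ℕ} (τ : ↥b ↪ ↥a) (x : D.obj a),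
    app b (D.map τ x) = E.map τ (app a x)

/-- A `ν`-almost-sure natural transformation of Borel data structures. -/
structure ASNatTrans (D E : BDS) (ν : ∀ a : Finset ℕ, Measure (D.obj a)) where
  app : ∀ a : Finset ℕ, D.obj a → E.obj a
  meas : ∀ a : Finset ℕ, Measurable (app a)
  natural : ∀ {b a : Finset ℕ} (τ : ↥b ↪ ↥a),
    ∀ᵐ x ∂(ν a), app b (D.map τ x) = E.map τ (app a x)
/-- `a*≠`: the finite tuples of pairwise distinct elements of `a`, encoded as
injections `Fin k → ↥a`. -/
abbrev Tup (a : Finset ℕ) : Type := Σ k : ℕ, {v : Fin k → ↥a // Function.Injective v}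

/-- The array-type Borel data structure `ARRAY(𝒳, □*≠)` over a standard Borel
space `𝒳`, with restriction `x ↦ x ∘ τ⃗`. -/
def ArrSeq (𝒳 : Type) [MeasurableSpace 𝒳] [StandardBorelSpace 𝒳] : BDS where
  obj a := Tup a → 𝒳
  mss _ := inferInstance
  sbs _ := inferInstance
  map τ x := fun t => x ⟨t.1, ⟨fun j => τ (t.2.1 j), τ.injective.comp t.2.2⟩⟩
  map_id a := by funext x t; rfl
  map_comp σ τ := by funext x t; rfl
  map_measurable τ := measurable_pi_lambda _ fun t => measurable_pi_apply _

/-- The identity tuple `(1, …, k)` over `[k] = Finset.range k`. -/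
def idTup (k : ℕ) : Tup (Finset.range k) :=
  ⟨k, ⟨fun j => ⟨j.1, Finset.mem_range.mpr j.2⟩,
    fun _j _j' h => Fin.ext (congrArg Subtype.val h)⟩⟩

/-- The injection `τ_{𝐢,a} : [k] → a`, `j ↦ i_j`, associated to a tuple
`𝐢 = (i_1, …, i_k) ∈ a*≠`. -/
def tupEmb {a : Finset ℕ} (t : Tup a) : ↥(Finset.range t.1) ↪ ↥a :=
  ⟨fun j => t.2.1 ⟨j.1, Finset.mem_range.mp j.2⟩,
   fun _j _j' h => Subtype.ext (congrArg Fin.val (t.2.2 h))⟩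

/-- The restriction of an array along `tupEmb t`, read at the identity tuple, is its
value at `t`. -/
theorem ArrSeq.map_tupEmb_idTup {𝒳 : Type} [MeasurableSpace 𝒳] [StandardBorelSpace 𝒳]
    {a : Finset ℕ} (t : Tup a) (y : (ArrSeq 𝒳).obj a) :
    (ArrSeq 𝒳).map (tupEmb t) y (idTup t.1) = y t := rfl

theorem tupEmb_idTup (k : ℕ) :
    tupEmb (idTup k) = Function.Embedding.refl ↥(Finset.range k) := rfl

theorem NT.ext_app {D E : BDS} {η θ : NT D E} (h : η.app = θ.app) : η = θ := by
  cases η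
  cases θ
  cases h
  rfl

/-- The component of a natural transformation into an array structure at a tuple `t` is
determined by its component at the identity tuple. -/
theorem NT.app_idTup_map_tupEmb {D : BDS} {𝒳 : Type} [MeasurableSpace 𝒳]
    [StandardBorelSpace 𝒳] (η : NT D (ArrSeq 𝒳)) {a : Finset ℕ} (d : D.obj a) (t : Tup a) :
    η.app (Finset.range t.1) (D.map (tupEmb t) d) (idTup t.1) = η.app a d t := by
  rw [η.natural, ArrSeq.map_tupEmb_idTup]

/-- The natural transformation into an array structure given by a sequence of measurable
kernel functions. -/
def NT.ofKernels {D : BDS} {𝒳 : Type} [MeasurableSpace 𝒳] [StandardBorelSpace 𝒳]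
    (f : (k : ℕ) → D.obj (Finset.range k) → 𝒳) (hf : ∀ k, Measurable (f k)) :
    NT D (ArrSeq 𝒳) where
  app _ d := fun t => f t.1 (D.map (tupEmb t) d)
  meas _ := measurable_pi_lambda _ fun t => (hf t.1).comp (D.map_measurable (tupEmb t))
  natural τ x := by
    funext t
    exact congrArg (f t.1) (congrFun (D.map_comp (tupEmb t) τ) x).symm

/-- The kernel functions of a natural transformation into an array structure are
measurable. -/
theorem NT.measurable_app_idTup {D : BDS} {𝒳 : Type} [MeasurableSpace 𝒳]
    [StandardBorelSpace 𝒳] (η : NT D (ArrSeq 𝒳)) (k : ℕ) :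
    Measurable fun d => η.app (Finset.range k) d (idTup k) :=
  (measurable_pi_apply (idTup k)).comp (η.meas (Finset.range k))

/-- Characterization of natural transformations into `ARRAY(𝒳, □*≠)`: they
correspond bijectively to sequences of measurable kernel functions
`f_k : D_{[k]} → 𝒳`, via `f_k = η_{[k],(1,…,k)}` and, conversely,
`η_{a,𝐢} = f_k ∘ D[τ_{𝐢,a}]`. -/
theorem natTrans_into_seqArray_correspondence
    (D : BDS) (𝒳 : Type) [MeasurableSpace 𝒳] [StandardBorelSpace 𝒳] :
    ∃ e : NT D (ArrSeq 𝒳) ≃ {f : (k : ℕ) → D.obj (Finset.range k) → 𝒳 // ∀ k, Measurable (f k)},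
      (∀ (η : NT D (ArrSeq 𝒳)) (k : ℕ) (d : D.obj (Finset.range k)),
        (e η).val k d = η.app (Finset.range k) d (idTup k)) ∧
      (∀ (f : {f : (k : ℕ) → D.obj (Finset.range k) → 𝒳 // ∀ k, Measurable (f k)})
          (a : Finset ℕ) (d : D.obj a) (t : Tup a),
        (e.symm f).app a d t = f.val t.1 (D.map (tupEmb t) d)) := by
  refine ⟨{
    toFun := fun η =>
      ⟨fun k d => η.app (Finset.range k) d (idTup k), η.measurable_app_idTup⟩
    invFun := fun f => NT.ofKernels f.1 f.2
    left_inv := fun η => NT.ext_app ?_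
    right_inv := fun f => Subtype.ext ?_ }, fun _ _ _ => rfl, fun _ _ _ _ => rfl⟩
  · funext a d t
    exact η.app_idTup_map_tupEmb d t
  · funext k d
    change f.1 k (D.map (tupEmb (idTup k)) d) = f.1 k d
    rw [tupEmb_idTup, D.map_id, id]
end

section
/- Every Borel data structure D over ℕ can be naturally embedded into ARRAY([0,1],□*≠): there exists a natural transformation φ : D → ARRAY([0,1],□*≠) all of whose components φ_a : D_a → [0,1]^{a*≠} are injective. Consequently, every Borel data structure over ℕ is naturally isomorphic to a sub-data structure of ARRAY([0,1],□*≠). -/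
open MeasureTheory ProbabilityTheory

instance : PolishSpace unitInterval := isClosed_Icc.polishSpace

namespace BDS

/-- Restriction along a surjective injection is injective. -/
theorem map_injective_of_surjective (D : BDS) {b a : Finset ℕ} (τ : ↥b ↪ ↥a)
    (hτ : Function.Surjective τ) : Function.Injective (D.map τ) := by
  let e : ↥b ≃ ↥a := Equiv.ofBijective τ ⟨τ.injective, hτ⟩
  have h : e.symm.toEmbedding.trans τ = Function.Embedding.refl ↥a := by
    ext i
    exact congrArg Subtype.val (e.apply_symm_apply i)
  have hcomp : D.map e.symm.toEmbedding ∘ D.map τ = id := by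
    rw [← D.map_comp, h, D.map_id]
  exact Function.LeftInverse.injective (congrFun hcomp)

/-- The natural transformation into the array data structure over `[0,1]` whose entry at a
tuple `t` of length `k` is a `[0,1]`-code of the restriction along `tupEmb t` to `[k]`. -/
noncomputable def toSeqArray (D : BDS) : NT D (ArrSeq unitInterval) where
  app _ x t := unitInterval.sigmoid (embeddingReal _ (D.map (tupEmb t) x))
  meas _ := measurable_pi_lambda _ fun t =>
    (measurableEmbedding_sigmoid_comp_embeddingReal _).measurable.comp
      (D.map_measurable (tupEmb t))
  natural τ x := by
    funext t
    change unitInterval.sigmoid (embeddingReal _ ((D.map (tupEmb t) ∘ D.map τ) x)) = _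
    rw [← D.map_comp]
    rfl

theorem toSeqArray_injective (D : BDS) (a : Finset ℕ) :
    Function.Injective (D.toSeqArray.app a) := by
  intro x y hxy
  let t : Tup a := ⟨a.card, a.equivFin.symm, a.equivFin.symm.injective⟩
  have ht : Function.Surjective (tupEmb t) := fun i =>
    ⟨⟨a.equivFin i, Finset.mem_range.mpr (a.equivFin i).2⟩, a.equivFin.symm_apply_apply i⟩
  exact D.map_injective_of_surjective _ ht
    ((measurableEmbedding_sigmoid_comp_embeddingReal _).injective (congrFun hxy t))

end BDS

/-- Universality of `ARRAY([0,1], □*≠)`: every Borel data structure embeds into it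
via a natural transformation with injective components; consequently it is naturally
isomorphic to a sub-data structure (a family of measurable subsets stable under all
restriction maps) of `ARRAY([0,1], □*≠)`. -/
theorem embedding_into_unitInterval_seqArray (D : BDS) :
    ∃ φ : NT D (ArrSeq unitInterval),
      (∀ a : Finset ℕ, Function.Injective (φ.app a)) ∧
      (∀ a : Finset ℕ, MeasurableSet (Set.range (φ.app a))) ∧
      (∀ (b a : Finset ℕ) (τ : ↥b ↪ ↥a) (x : (ArrSeq unitInterval).obj a),
        x ∈ Set.range (φ.app a) →
          (ArrSeq unitInterval).map τ x ∈ Set.range (φ.app b)) := by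
  refine ⟨D.toSeqArray, D.toSeqArray_injective, fun a => ?_, ?_⟩
  · exact ((D.toSeqArray.meas a).measurableEmbedding
      (D.toSeqArray_injective a)).measurableSet_range
  · rintro b a τ _ ⟨x, rfl⟩
    exact ⟨D.map τ x, D.toSeqArray.natural τ x⟩
end

section
/- Weak functional representation theorem: let D be a Borel data structure over ℕ and μ an exchangeable law on D. Then there exists a unif(R)-almost-sure natural transformation η : R → D such that μ = unif(R) ∘ η^{-1}, i.e. for every finite a ⊆ ℕ one has μ_a = unif(R)_a ∘ η_a^{-1}, where R is the uniform randomizer and unif(R)_a is the product of Uniform[0,1] over 2^a. -/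
open MeasureTheory ProbabilityTheory

/-- The uniform distribution on `[0,1]`. -/
noncomputable def unifMeas : Measure ℝ := volume.restrict (Set.Icc 0 1)

/-- The uniform randomizer `R`: the Borel data structure `a ↦ [0,1]^(2^a)` with
restriction `u ↦ u ∘ im(τ)`. -/
def RR : BDS where
  obj a := Finset ↥a → ℝ
  mss _ := inferInstance
  sbs _ := inferInstance
  map τ u := fun s => u (s.map τ)
  map_id a := by funext u s; simp
  map_comp σ τ := by funext u s; simp [Finset.map_map]
  map_measurable τ := measurable_pi_lambda _ fun s => measurable_pi_apply _

/-- The exchangeable law `unif(R)`: on each `[0,1]^(2^a)` the product of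
Uniform[0,1] measures over `2^a`. -/
noncomputable def unifRLaw : ∀ a : Finset ℕ, Measure (RR.obj a) :=
  fun a => Measure.pi fun _ : Finset ↥a => unifMeas

/-- The subsets of `a` of cardinality at most `k`. -/
abbrev SmallSets (a : Finset ℕ) (k : ℕ) : Type := {s : Finset ↥a // s.card ≤ k}

/-- The depth-`k` uniform randomizer `R^k`: the Borel data structure
`a ↦ [0,1]^(Binom(a,≤k))` with restriction `u ↦ u ∘ im(τ)`. -/
def Rk (k : ℕ) : BDS where
  obj a := SmallSets a k → ℝ
  mss _ := inferInstance
  sbs _ := inferInstance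
  map τ u := fun s => u ⟨s.val.map τ, by rw [Finset.card_map]; exact s.prop⟩
  map_id a := by
    funext u s
    exact congrArg u (Subtype.ext (by simp))
  map_comp σ τ := by
    funext u s
    exact congrArg u (Subtype.ext (by simp [Finset.map_map]))
  map_measurable τ := measurable_pi_lambda _ fun s => measurable_pi_apply _

/-- The exchangeable law `unif(R^k)`: on each `[0,1]^(Binom(a,≤k))` the product of
Uniform[0,1] measures. -/
noncomputable def unifRkLaw (k : ℕ) : ∀ a : Finset ℕ, Measure ((Rk k).obj a) :=
  fun a => Measure.pi fun _ : SmallSets a k => unifMeas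

/-- `D` is `k`-determined: elements of any `D_a` are distinguished by their
restrictions to subsets of size at most `k`. -/
def kDetermined (D : BDS) (k : ℕ) : Prop :=
  ∀ (a : Finset ℕ) (x y : D.obj a),
    (∀ (a' : Finset ℕ) (h : a' ⊆ a), a'.card ≤ k →
      D.map (inclEmb h) x = D.map (inclEmb h) y) → x = y

instance isProbabilityMeasure_unifMeas : IsProbabilityMeasure unifMeas :=
  ⟨by simp [unifMeas]⟩

instance nullSingletonClass_unifMeas : NullSingletonClass unifMeas := by
  unfold unifMeas; infer_instance

theorem map_projIcc_unifMeas :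
    unifMeas.map (Set.projIcc (0 : ℝ) 1 zero_le_one) = (volume : Measure unitInterval) := by
  have h : unifMeas = (volume : Measure unitInterval).map Subtype.val :=
    (unitInterval.measurePreserving_coe.map_eq).symm
  have hm : Measurable (Set.projIcc (0 : ℝ) 1 zero_le_one) := continuous_projIcc.measurable
  rw [h, Measure.map_map hm measurable_subtype_coe]
  have : Set.projIcc (0 : ℝ) 1 zero_le_one ∘ (Subtype.val : unitInterval → ℝ) = id := by
    funext x
    exact Set.projIcc_val _ x
  rw [this, Measure.map_id]

/-- Isolation of the randomness of a Markov kernel, with noise distributed as `unifMeas`. -/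
theorem exists_measurable_map_unifMeas_eq {X Y : Type*} [MeasurableSpace X] [MeasurableSpace Y]
    [StandardBorelSpace Y] [Nonempty Y] (κ : Kernel X Y) [IsMarkovKernel κ] :
    ∃ f : X → ℝ → Y, Measurable (Function.uncurry f) ∧ ∀ a, unifMeas.map (f a) = κ a := by
  obtain ⟨f, hf, hfκ⟩ := κ.exists_measurable_map_eq_unitInterval
  have hm : Measurable (Set.projIcc (0 : ℝ) 1 zero_le_one) := continuous_projIcc.measurable
  refine ⟨fun a x => f a (Set.projIcc 0 1 zero_le_one x),
    hf.comp (measurable_fst.prodMk (hm.comp measurable_snd)), fun a => ?_⟩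
  have hfa : Measurable (f a) := hf.comp measurable_prodMk_left
  rw [← hfκ a, ← map_projIcc_unifMeas, Measure.map_map hfa hm]
  rfl

theorem measurable_update_prod {ι S : Type*} [DecidableEq ι] [MeasurableSpace S] (i : ι) :
    Measurable fun p : (ι → S) × S => Function.update p.1 i p.2 := by
  refine measurable_pi_lambda _ fun j => ?_
  by_cases h : j = i
  · subst h; simpa using measurable_snd
  · simpa [Function.update_of_ne h, Function.comp_def] using
      (measurable_pi_apply j).comp (measurable_fst (α := ι → S) (β := S))

section Update

variable {ι S : Type*} [DecidableEq ι] [MeasurableSpace S] (ν : Measure S)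
  [IsProbabilityMeasure ν]

theorem map_update_infinitePi (i : ι) :
    ((Measure.infinitePi fun _ : ι => ν).prod ν).map (fun p => Function.update p.1 i p.2) =
      Measure.infinitePi fun _ : ι => ν := by
  classical
  have hm := measurable_update_prod (S := S) i
  refine Measure.eq_infinitePi _ fun s t ht => ?_
  rw [Measure.map_apply hm (MeasurableSet.pi s.countable_toSet fun j _ => ht j)]
  have hpre : (fun p : (ι → S) × S => Function.update p.1 i p.2) ⁻¹' (Set.pi s t) =
      (Set.pi (s.erase i : Finset ι) t) ×ˢ (if i ∈ s then t i else Set.univ) := by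
    ext p
    simp only [Set.mem_preimage, Set.mem_pi, Finset.mem_coe, Set.mem_prod, Finset.mem_erase]
    constructor
    · intro h
      refine ⟨fun j hj => by simpa [Function.update_of_ne hj.1] using h j hj.2, ?_⟩
      split_ifs with hi
      · simpa using h i hi
      · trivial
    · rintro ⟨h1, h2⟩ j hj
      by_cases hji : j = i
      · subst hji; simpa [hj] using h2
      · simpa [Function.update_of_ne hji] using h1 j ⟨hji, hj⟩
  rw [hpre, Measure.prod_prod, Measure.infinitePi_pi _ (fun j _ => ht j)]
  by_cases hi : i ∈ s
  · simp only [hi, if_true]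
    rw [mul_comm, Finset.mul_prod_erase s (fun j => ν (t j)) hi]
  · simp [hi]

/-- A variable not depending on the `i`-th coordinate is independent of that coordinate. -/
theorem map_prodMk_eval_infinitePi {V : Type*} [MeasurableSpace V] {W : (ι → S) → V}
    (hW : Measurable W) (i : ι) (hWi : ∀ u x, W (Function.update u i x) = W u) :
    (Measure.infinitePi fun _ : ι => ν).map (fun u => (W u, u i)) =
      ((Measure.infinitePi fun _ : ι => ν).map W).prod ν := by
  have hm := measurable_update_prod (S := S) i
  conv_lhs => rw [← map_update_infinitePi ν i]
  rw [Measure.map_map (by fun_prop) hm]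
  have : (fun u : ι → S => (W u, u i)) ∘ (fun p : (ι → S) × S => Function.update p.1 i p.2) =
      Prod.map W id := by
    funext p
    simp [hWi, Prod.map]
  rw [this, ← Measure.map_prod_map _ _ hW measurable_id, Measure.map_id]

end Update

theorem map_prodMk_isolated {ι V Y : Type*} [DecidableEq ι] [MeasurableSpace V]
    [MeasurableSpace Y] {W : (ι → ℝ) → V} (hW : Measurable W) (i : ι)
    (hWi : ∀ u x, W (Function.update u i x) = W u) (κ : Kernel V Y) [IsMarkovKernel κ]
    {f : V → ℝ → Y} (hf : Measurable (Function.uncurry f)) (hfκ : ∀ v, unifMeas.map (f v) = κ v) :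
    (Measure.infinitePi fun _ : ι => unifMeas).map (fun u => (W u, f (W u) (u i))) =
      ((Measure.infinitePi fun _ : ι => unifMeas).map W) ⊗ₘ κ := by
  have h1 : (fun u : ι → ℝ => (W u, f (W u) (u i))) =
      (fun p : V × ℝ => (p.1, f p.1 p.2)) ∘ fun u => (W u, u i) := rfl
  have h2 : Measurable fun p : V × ℝ => (p.1, f p.1 p.2) := measurable_fst.prodMk hf
  have : IsProbabilityMeasure ((Measure.infinitePi fun _ : ι => unifMeas).map W) :=
    Measure.isProbabilityMeasure_map hW.aemeasurable
  rw [h1, ← Measure.map_map h2 (by fun_prop), map_prodMk_eval_infinitePi unifMeas hW i hWi]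
  ext A hA
  rw [Measure.map_apply h2 hA, Measure.prod_apply (h2 hA), Measure.compProd_apply hA]
  refine lintegral_congr fun v => ?_
  have hfv : Measurable (f v) := hf.comp measurable_prodMk_left
  rw [← hfκ v, Measure.map_apply hfv (measurable_prodMk_left hA)]
  rfl

section Conditioning

variable {Ω V S : Type*} [MeasurableSpace Ω] [MeasurableSpace V] [MeasurableSpace S]
  [StandardBorelSpace S] [Nonempty S] {P : Measure Ω} [IsProbabilityMeasure P]
  {X : Ω → S} {W : Ω → V}

theorem setIntegral_preimage_eq_integral_condDistrib_mul (hX : Measurable X) (hW : Measurable W)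
    {A : Set S} (hA : MeasurableSet A) {φ : V → ℝ} (hφ : Measurable φ) {C : ℝ}
    (hC : ∀ v, |φ v| ≤ C) :
    ∫ ω in X ⁻¹' A, φ (W ω) ∂P = ∫ ω, (condDistrib X W P (W ω)).real A * φ (W ω) ∂P := by
  have hmap := compProd_map_condDistrib (mβ := ‹_›) (X := W) (μ := P) hX.aemeasurable
  have hf : Measurable fun p : V × S => A.indicator 1 p.2 * φ p.1 := by
    exact ((measurable_const.indicator hA).comp measurable_snd).mul (hφ.comp measurable_fst)
  have hWX : Measurable fun ω => (W ω, X ω) := hW.prodMk hX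
  have hPW : IsProbabilityMeasure (P.map W) := Measure.isProbabilityMeasure_map hW.aemeasurable
  have hint : Integrable (fun p : V × S => A.indicator 1 p.2 * φ p.1)
      (P.map W ⊗ₘ condDistrib X W P) := by
    refine Integrable.of_bound hf.aestronglyMeasurable C (Filter.Eventually.of_forall fun p => ?_)
    rw [norm_mul]
    have h0 : 0 ≤ C := (abs_nonneg _).trans (hC p.1)
    by_cases hp : p.2 ∈ A
    · simpa [hp] using hC p.1
    · simpa [hp] using h0
  calc ∫ ω in X ⁻¹' A, φ (W ω) ∂P
      = ∫ ω, A.indicator 1 (X ω) * φ (W ω) ∂P := by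
        rw [← integral_indicator (hX hA)]
        refine integral_congr_ae (Filter.Eventually.of_forall fun ω => ?_)
        by_cases hω : X ω ∈ A <;> simp [Set.indicator, hω]
    _ = ∫ p, A.indicator 1 p.2 * φ p.1 ∂(P.map fun ω => (W ω, X ω)) :=
        (integral_map hWX.aemeasurable hf.aestronglyMeasurable).symm
    _ = ∫ v, ∫ x, A.indicator 1 x * φ v ∂(condDistrib X W P v) ∂(P.map W) := by
        rw [← hmap, Measure.integral_compProd hint]
    _ = ∫ v, (condDistrib X W P v).real A * φ v ∂(P.map W) := by
        refine integral_congr_ae (Filter.Eventually.of_forall fun v => ?_)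
        simp only
        rw [integral_mul_const, integral_indicator_one hA]
    _ = _ := by
        rw [integral_map hW.aemeasurable]
        exact (((condDistrib X W P).measurable_coe hA).ennreal_toReal.mul hφ).aestronglyMeasurable

/-- If a measure preserving map fixes the event `X ∈ A` and turns `W` into a function `r W` of
itself, then the conditional probability of `X ∈ A` given `W` depends only on `r W`. -/
theorem condDistrib_real_comp_ae_eq (hX : Measurable X) (hW : Measurable W) {T : Ω → Ω}
    (hT : MeasurePreserving T P P) {r : V → V} (hr : Measurable r)
    (hWT : ∀ ω, W (T ω) = r (W ω)) {A : Set S} (hA : MeasurableSet A)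
    (hXT : T ⁻¹' (X ⁻¹' A) = X ⁻¹' A) :
    ∀ᵐ ω ∂P, (condDistrib X W P (W ω)).real A = (condDistrib X W P (r (W ω))).real A := by
  set k : V → ℝ := fun v => (condDistrib X W P v).real A with hk
  have hkm : Measurable k := ((condDistrib X W P).measurable_coe hA).ennreal_toReal
  have hkb : ∀ v, |k v| ≤ 1 := fun v => by
    rw [abs_of_nonneg measureReal_nonneg]; exact measureReal_le_one
  have hkW : Measurable fun ω => k (W ω) := hkm.comp hW
  have hkr : Measurable fun ω => k (r (W ω)) := hkm.comp (hr.comp hW)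
  have hI : ∀ {f g : Ω → V}, Measurable f → Measurable g →
      Integrable (fun ω => k (f ω) * k (g ω)) P := fun {f g} hf hg => by
    refine Integrable.of_bound ((hkm.comp hf).mul (hkm.comp hg)).aestronglyMeasurable 1
      (Filter.Eventually.of_forall fun ω => ?_)
    rw [norm_mul]
    exact mul_le_one₀ (hkb _) (norm_nonneg _) (hkb _)
  have h1 : ∫ ω in X ⁻¹' A, k (W ω) ∂P = ∫ ω, k (W ω) * k (W ω) ∂P :=
    setIntegral_preimage_eq_integral_condDistrib_mul hX hW hA hkm hkb
  have h2 : ∫ ω in X ⁻¹' A, k (r (W ω)) ∂P = ∫ ω, k (W ω) * k (r (W ω)) ∂P :=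
    setIntegral_preimage_eq_integral_condDistrib_mul hX hW hA (hkm.comp hr) fun v => hkb _
  have h3 : ∫ ω in X ⁻¹' A, k (r (W ω)) ∂P = ∫ ω in X ⁻¹' A, k (W ω) ∂P := by
    have hmr : P.restrict (X ⁻¹' A) = (P.restrict (X ⁻¹' A)).map T := by
      conv_rhs => rw [← hXT]
      rw [← Measure.restrict_map hT.measurable (hX hA), hT.map_eq]
    conv_rhs => rw [hmr]
    rw [integral_map hT.measurable.aemeasurable hkW.aestronglyMeasurable]
    simp [hWT]
  have h4 : ∫ ω, k (r (W ω)) * k (r (W ω)) ∂P = ∫ ω, k (W ω) * k (W ω) ∂P := by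
    conv_rhs => rw [← hT.map_eq]
    rw [integral_map hT.measurable.aemeasurable (hkW.fun_mul hkW).aestronglyMeasurable]
    simp [hWT]
  have h5 : ∫ ω, (k (W ω) - k (r (W ω))) ^ 2 ∂P = 0 := by
    have : ∀ ω, (k (W ω) - k (r (W ω))) ^ 2 =
        k (W ω) * k (W ω) - 2 * (k (W ω) * k (r (W ω))) + k (r (W ω)) * k (r (W ω)) :=
      fun ω => by ring
    simp_rw [this]
    rw [integral_add, integral_sub, integral_const_mul]
    · linarith
    · exact hI hW hW
    · exact (hI hW (hr.comp hW)).const_mul 2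
    · exact (hI hW hW).sub ((hI hW (hr.comp hW)).const_mul 2)
    · exact hI (hr.comp hW) (hr.comp hW)
  have h6 : Integrable (fun ω => (k (W ω) - k (r (W ω))) ^ 2) P := by
    refine Integrable.of_bound ((hkW.sub hkr).pow_const 2).aestronglyMeasurable 4
      (Filter.Eventually.of_forall fun ω => ?_)
    have := hkb (W ω)
    have := hkb (r (W ω))
    rw [abs_le] at *
    rw [Real.norm_eq_abs, abs_le]
    constructor <;> nlinarith
  have h7 := (integral_eq_zero_iff_of_nonneg (fun ω => sq_nonneg _) h6).1 h5
  filter_upwards [h7] with ω hω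
  have : k (W ω) - k (r (W ω)) = 0 := by simpa using hω
  linarith

/-- A criterion for `X` and `W` to be conditionally independent given `q W`. -/
theorem map_prodMk_eq_compProd_comap {V' : Type*} [MeasurableSpace V'] (hX : Measurable X)
    (hW : Measurable W) {q : V → V'} (hq : Measurable q) (κ : Kernel V' S) [IsMarkovKernel κ]
    (hκ : P.map (fun ω => (q (W ω), X ω)) = P.map (fun ω => q (W ω)) ⊗ₘ κ) (C : Set (Set S))
    (hC : ‹MeasurableSpace S› = MeasurableSpace.generateFrom C) (hCπ : IsPiSystem C)
    (hT : ∀ A ∈ C, ∃ (T : Ω → Ω) (r : V' → V), MeasurePreserving T P P ∧ Measurable r ∧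
      (∀ ω, W (T ω) = r (q (W ω))) ∧ T ⁻¹' (X ⁻¹' A) = X ⁻¹' A) :
    P.map (fun ω => (W ω, X ω)) = P.map W ⊗ₘ κ.comap q hq := by
  have hWX : Measurable fun ω => (W ω, X ω) := hW.prodMk hX
  have hPW : IsProbabilityMeasure (P.map W) := Measure.isProbabilityMeasure_map hW.aemeasurable
  have hPWX : IsProbabilityMeasure (P.map fun ω => (W ω, X ω)) :=
    Measure.isProbabilityMeasure_map hWX.aemeasurable
  have hqW := hq.comp hW
  have hkey : ∀ A ∈ C, ∀ᵐ ω ∂P, κ (q (W ω)) A = condDistrib X W P (W ω) A := by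
    intro A hAC
    have hA : MeasurableSet A := by rw [hC]; exact MeasurableSpace.measurableSet_generateFrom hAC
    obtain ⟨T, r, hTP, hr, hWT, hXT⟩ := hT A hAC
    have e1 := condDistrib_real_comp_ae_eq hX hW hTP (hr.comp hq) hWT hA hXT
    have e2 := condDistrib_ae_eq_condExp (μ := P) hW hX hA
    have e3 := condDistrib_ae_eq_condExp (μ := P) hqW hX hA
    have hκ' : condDistrib X (fun ω => q (W ω)) P =ᵐ[P.map fun ω => q (W ω)] κ :=
      condDistrib_ae_eq_of_measure_eq_compProd (fun ω => q (W ω)) hX.aemeasurable hκ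
    have e4 := ae_of_ae_map hqW.aemeasurable hκ'
    have hle : MeasurableSpace.comap (q ∘ W) inferInstance ≤
        MeasurableSpace.comap W inferInstance := by
      rw [← MeasurableSpace.comap_comp]
      exact MeasurableSpace.comap_mono hq.comap_le
    have hleW : MeasurableSpace.comap W inferInstance ≤ ‹MeasurableSpace Ω› := hW.comap_le
    have e5 := condExp_condExp_of_le (μ := P) (f := (X ⁻¹' A).indicator fun _ => (1 : ℝ)) hle hleW
    set g : Ω → ℝ := fun ω => (condDistrib X W P (r (q (W ω)))).real A with hg
    have hgm : Measurable[MeasurableSpace.comap (q ∘ W) inferInstance] g :=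
      (((condDistrib X W P).measurable_coe hA).ennreal_toReal.comp hr).comp
        (comap_measurable (q ∘ W))
    have hgi : Integrable g P := by
      refine Integrable.of_bound (hgm.mono (hle.trans hleW) le_rfl).aestronglyMeasurable 1
        (Filter.Eventually.of_forall fun ω => ?_)
      rw [Real.norm_eq_abs, abs_of_nonneg measureReal_nonneg]
      exact measureReal_le_one
    have e6 : P[P[(X ⁻¹' A).indicator (fun _ => (1 : ℝ)) | MeasurableSpace.comap W inferInstance]
        | MeasurableSpace.comap (q ∘ W) inferInstance] =ᵐ[P] g := by
      refine (condExp_congr_ae (e2.symm.trans e1)).trans ?_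
      exact (condExp_of_stronglyMeasurable (hle.trans hleW) hgm.stronglyMeasurable hgi).eventuallyEq
    filter_upwards [e1, e3, e4, e5, e6] with ω h1 h3 h4 h5 h6
    have h : (κ (q (W ω))).real A = (condDistrib X W P (W ω)).real A := by
      have h4' : condDistrib X (q ∘ W) P ((q ∘ W) ω) = κ (q (W ω)) := h4
      rw [h1, ← h4']
      exact h3.trans (h5.symm.trans h6)
    rwa [measureReal_def, measureReal_def, ENNReal.toReal_eq_toReal_iff' (by simp) (by simp)] at h
  have hmap := compProd_map_condDistrib (mβ := ‹_›) (X := W) (μ := P) hX.aemeasurable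
  rw [← hmap]
  have hrect : ∀ B : Set V, MeasurableSet B → ∀ A : Set S, MeasurableSet A →
      (P.map W ⊗ₘ condDistrib X W P) (B ×ˢ A) = (P.map W ⊗ₘ κ.comap q hq) (B ×ˢ A) := by
    intro B hB A hA
    have : ((P.map W ⊗ₘ condDistrib X W P).restrict (B ×ˢ Set.univ)).map Prod.snd =
        ((P.map W ⊗ₘ κ.comap q hq).restrict (B ×ˢ Set.univ)).map Prod.snd := by
      have hap : ∀ (η : Kernel V S) [IsMarkovKernel η] (A : Set S), MeasurableSet A →
          ((P.map W ⊗ₘ η).restrict (B ×ˢ Set.univ)).map Prod.snd A =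
            ∫⁻ v in B, η v A ∂(P.map W) := fun η _ A hA => by
        rw [Measure.map_apply measurable_snd hA, Measure.restrict_apply (measurable_snd hA),
          ← Measure.compProd_apply_prod hB hA]
        congr 1
        ext p
        simp [and_comm]
      refine ext_of_generate_finite C hC hCπ (fun A hAC => ?_) ?_
      · have hA : MeasurableSet A := by
          rw [hC]; exact MeasurableSpace.measurableSet_generateFrom hAC
        rw [hap _ A hA, hap _ A hA]
        refine setLIntegral_congr_fun_ae hB ?_
        have hae : ∀ᵐ v ∂(P.map W), condDistrib X W P v A = κ.comap q hq v A := by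
          rw [ae_map_iff hW.aemeasurable (measurableSet_eq_fun ((condDistrib X W P).measurable_coe hA)
            ((κ.comap q hq).measurable_coe hA))]
          filter_upwards [hkey A hAC] with ω hω
          simpa using hω.symm
        filter_upwards [hae] with v hv _ using hv
      · rw [hap _ _ .univ, hap _ _ .univ]
        simp
    have h := congrArg (fun m => m A) this
    rw [Measure.map_apply measurable_snd hA, Measure.map_apply measurable_snd hA,
      Measure.restrict_apply (measurable_snd hA), Measure.restrict_apply (measurable_snd hA)] at h
    have hset : Prod.snd ⁻¹' A ∩ B ×ˢ (Set.univ : Set S) = B ×ˢ A := by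
      ext p
      simp [and_comm]
    rwa [hset] at h
  exact Measure.ext_prod fun {B A} hB hA => hrect B hB A hA

end Conditioning

section Enumeration

open Finset

theorem exists_orderEmbedding_map_range (b : Finset ℕ) :
    ∃ f : ℕ ↪o ℕ, (range b.card).map f.toEmbedding = b := by
  let f : ℕ → ℕ := fun i =>
    if h : i < b.card then b.orderEmbOfFin rfl ⟨i, h⟩ else b.sup id + 1 + i
  have hf : StrictMono f := by
    intro i j hij
    simp only [f]
    split_ifs with h1 h2 h2
    · exact (b.orderEmbOfFin rfl).strictMono hij
    · have : b.orderEmbOfFin rfl ⟨i, h1⟩ ≤ b.sup id :=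
        le_sup (f := id) (b.orderEmbOfFin_mem rfl _)
      omega
    · omega
    · omega
  refine ⟨OrderEmbedding.ofStrictMono f hf, ?_⟩
  refine eq_of_subset_of_card_le (fun k hk => ?_) (by simp)
  obtain ⟨i, hi, rfl⟩ := mem_map.1 hk
  have hi' : i < b.card := mem_range.1 hi
  simp [f, hi']

/-- An increasing embedding of `ℕ` into itself whose first `b.card` values enumerate `b`. -/
noncomputable def enum (b : Finset ℕ) : ℕ ↪o ℕ := (exists_orderEmbedding_map_range b).choose

theorem map_enum (b : Finset ℕ) : (range b.card).map (enum b).toEmbedding = b :=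
  (exists_orderEmbedding_map_range b).choose_spec

theorem enum_mem {b : Finset ℕ} {i : ℕ} (hi : i < b.card) : enum b i ∈ b := by
  have h := mem_map_of_mem (enum b).toEmbedding (mem_range.2 hi)
  rwa [map_enum] at h

theorem exists_enum_eq {b : Finset ℕ} {k : ℕ} (hk : k ∈ b) : ∃ i < b.card, enum b i = k := by
  rw [← map_enum b] at hk
  simpa using hk

theorem enum_unique {b : Finset ℕ} {f : ℕ → ℕ} (hf : StrictMono f)
    (hb : ∀ i < b.card, f i ∈ b) {i : ℕ} (hi : i < b.card) : f i = enum b i := by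
  have h1 := orderEmbOfFin_unique (s := b) rfl (f := fun i => f i) (fun i => hb i i.2)
    fun i j hij => hf hij
  have h2 := orderEmbOfFin_unique (s := b) rfl (f := fun i => enum b i) (fun i => enum_mem i.2)
    fun i j hij => (enum b).strictMono hij
  exact congrFun (h1.trans h2.symm) ⟨i, hi⟩

theorem enum_map (f : ℕ ↪o ℕ) (s : Finset ℕ) {i : ℕ} (hi : i < s.card) :
    enum (s.map f.toEmbedding) i = f (enum s i) := by
  refine (enum_unique (f := fun i => f (enum s i)) (f.strictMono.comp (enum s).strictMono)
    (fun i hi => ?_) (by simpa using hi)).symm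
  exact mem_map_of_mem f.toEmbedding (enum_mem (by simpa using hi))

theorem enum_range {n i : ℕ} (hi : i < n) : enum (range n) i = i :=
  (enum_unique (b := range n) strictMono_id (fun i hi => by simpa using hi)
    (by simpa using hi)).symm

theorem map_congr_of_eqOn {s : Finset ℕ} {f g : ℕ ↪ ℕ} (h : ∀ i ∈ s, f i = g i) :
    s.map f = s.map g := by
  ext k
  simp only [mem_map]
  exact ⟨fun ⟨i, hi, e⟩ => ⟨i, hi, (h i hi) ▸ e⟩, fun ⟨i, hi, e⟩ => ⟨i, hi, (h i hi).symm ▸ e⟩⟩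

theorem map_enum_ssubset {c s : Finset ℕ} (hs : s ⊂ range c.card) :
    s.map (enum c).toEmbedding ⊂ c := by
  conv_rhs => rw [← map_enum c]
  exact map_ssubset_map.2 hs

/-- The injection sending `0, …, b.card - 1` to the doubles of the elements of `b`, and the
remaining numbers to the odd numbers. -/
noncomputable def evenOdd (b : Finset ℕ) : ℕ ↪ ℕ :=
  ⟨fun i => if i < b.card then 2 * enum b i else 2 * (i - b.card) + 1, fun i j h => by
    simp only at h
    split_ifs at h with h1 h2 h2
    · exact (enum b).injective (by omega)
    · omega
    · omega
    · omega⟩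

theorem evenOdd_apply (b : Finset ℕ) (i : ℕ) :
    evenOdd b i = if i < b.card then 2 * enum b i else 2 * (i - b.card) + 1 := rfl

theorem evenOdd_of_lt {b : Finset ℕ} {i : ℕ} (hi : i < b.card) :
    evenOdd b i = 2 * enum b i := if_pos hi

theorem evenOdd_card_add (b : Finset ℕ) (j : ℕ) : evenOdd b (b.card + j) = 2 * j + 1 := by
  simp [evenOdd_apply]

theorem evenOdd_of_le {b : Finset ℕ} {i : ℕ} (hi : b.card ≤ i) :
    evenOdd b i = 2 * (i - b.card) + 1 := if_neg (by omega)

/-- The injection acting by `f` on even numbers and fixing the odd numbers. -/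
def liftEven (f : ℕ ↪ ℕ) : ℕ ↪ ℕ :=
  ⟨fun i => if i % 2 = 0 then 2 * f (i / 2) else i, fun i j h => by
    simp only at h
    split_ifs at h with h1 h2 h2
    · have := f.injective (a₁ := i / 2) (a₂ := j / 2) (by omega)
      omega
    · omega
    · omega
    · omega⟩

theorem liftEven_apply (f : ℕ ↪ ℕ) (i : ℕ) :
    liftEven f i = if i % 2 = 0 then 2 * f (i / 2) else i := rfl

theorem evenOdd_map (f : ℕ ↪o ℕ) (s : Finset ℕ) :
    evenOdd (s.map f.toEmbedding) = (evenOdd s).trans (liftEven f.toEmbedding) := by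
  ext i
  by_cases hi : i < s.card
  · have h1 : i < (s.map f.toEmbedding).card := by simpa using hi
    simp [evenOdd_of_lt h1, evenOdd_of_lt hi, enum_map f s hi, liftEven_apply]
  · have h1 : (s.map f.toEmbedding).card ≤ i := by simpa using hi
    simp [evenOdd_of_le h1, evenOdd_of_le (not_lt.1 hi), liftEven_apply]

/-- The injection fixing `2 * i` for `i ∈ c` and the first `M` odd numbers, and sending
everything else to odd numbers. -/
def absorb (c : Finset ℕ) (M : ℕ) : ℕ ↪ ℕ :=
  ⟨fun k => if k % 2 = 0 then (if k / 2 ∈ c then k else 2 * (M + k + 1) + 1)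
      else if k / 2 < M then k else 2 * (k - 1 - M) + 1, fun i j h => by
    simp only at h
    split_ifs at h <;> omega⟩

theorem absorb_apply (c : Finset ℕ) (M k : ℕ) : absorb c M k =
    if k % 2 = 0 then (if k / 2 ∈ c then k else 2 * (M + k + 1) + 1)
      else if k / 2 < M then k else 2 * (k - 1 - M) + 1 := rfl

theorem exists_trans_absorb (b c : Finset ℕ) (M : ℕ) :
    ∃ χ : ℕ ↪ ℕ, (evenOdd b).trans (absorb c M) = χ.trans (evenOdd (b ∩ c)) := by
  have h : ∀ i, ∃ j, evenOdd (b ∩ c) j = absorb c M (evenOdd b i) := by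
    intro i
    have hodd : ∀ k, k % 2 = 1 → ∃ j, evenOdd (b ∩ c) j = k := fun k hk =>
      ⟨(b ∩ c).card + k / 2, by rw [evenOdd_card_add]; omega⟩
    by_cases hi : i < b.card
    · by_cases hc : enum b i ∈ c
      · obtain ⟨j, hj, hji⟩ := exists_enum_eq (mem_inter.2 ⟨enum_mem hi, hc⟩)
        refine ⟨j, ?_⟩
        rw [evenOdd_of_lt hj, evenOdd_of_lt hi, hji]
        simp [absorb_apply, hc]
      · apply hodd
        rw [evenOdd_of_lt hi]
        simp [absorb_apply, hc]
    · apply hodd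
      rw [evenOdd_of_le (not_lt.1 hi)]
      rw [absorb_apply]
      split_ifs <;> omega
  choose χ hχ using h
  refine ⟨⟨χ, fun i j hij => ?_⟩, ?_⟩
  · have := (hχ i).symm.trans ((congrArg _ hij).trans (hχ j))
    exact (evenOdd b).injective ((absorb c M).injective this)
  · ext i
    exact (hχ i).symm

theorem absorb_evenOdd (c : Finset ℕ) {M i : ℕ} (hi : i < c.card + M) :
    absorb c M (evenOdd c i) = evenOdd c i := by
  by_cases h : i < c.card
  · rw [evenOdd_of_lt h]
    simp [absorb_apply, enum_mem h]
  · rw [evenOdd_of_le (not_lt.1 h)]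
    rw [absorb_apply]
    split_ifs <;> omega

end Enumeration

namespace BDS

variable {D : BDS}

/-- A choice of an element of `D.obj a` for every `a`, not necessarily compatible with the
restriction maps. -/
abbrev Family (D : BDS) : Type := ∀ a : Finset ℕ, D.obj a

theorem map_apply_congr (ω : D.Family) {a b b' : Finset ℕ} (τ : ↥a ↪ ↥b) (τ' : ↥a ↪ ↥b')
    (h : b = b') (hτ : ∀ i, (τ i : ℕ) = τ' i) : D.map τ (ω b) = D.map τ' (ω b') := by
  subst h
  congr 1
  ext i
  exact hτ i

theorem map_map_apply {a b c : Finset ℕ} (σ : ↥c ↪ ↥b) (τ : ↥b ↪ ↥a) (x : D.obj a) :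
    D.map σ (D.map τ x) = D.map (σ.trans τ) x := by
  rw [D.map_comp]; rfl

/-- The bijection `a → φ(a)` induced by `φ`. -/
def embOn (φ : ℕ ↪ ℕ) (a : Finset ℕ) : ↥a ↪ ↥(a.map φ) :=
  ⟨fun i => ⟨φ i, Finset.mem_map_of_mem φ i.2⟩, fun _ _ h =>
    Subtype.ext (φ.injective (congrArg Subtype.val h))⟩

/-- Relabelling of a family along an injection of `ℕ`. -/
def shift (D : BDS) (φ : ℕ ↪ ℕ) (ω : D.Family) : D.Family :=
  fun a => D.map (embOn φ a) (ω (a.map φ))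

theorem shift_trans (φ θ : ℕ ↪ ℕ) (ω : D.Family) :
    D.shift (φ.trans θ) ω = D.shift φ (D.shift θ ω) := by
  funext a
  simp only [shift, map_map_apply]
  exact map_apply_congr ω _ _ (Finset.map_map φ θ a).symm fun i => rfl

theorem shift_apply_congr {φ ψ : ℕ ↪ ℕ} {a : Finset ℕ} (h : ∀ i ∈ a, φ i = ψ i) (ω : D.Family) :
    D.shift φ ω a = D.shift ψ ω a :=
  map_apply_congr ω _ _ (map_congr_of_eqOn h) fun i => h i i.2

theorem measurable_shift (φ : ℕ ↪ ℕ) : Measurable (D.shift φ) :=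
  measurable_pi_lambda _ fun _ => (D.map_measurable _).comp (measurable_pi_apply _)

end BDS

/-- A law of a random family whose marginals are given by `μ` and which is almost surely
compatible with restrictions. -/
structure IsCoherent {D : BDS} (μ : ExchLaw D) (P : Measure D.Family) : Prop where
  map_eval : ∀ a, P.map (fun ω => ω a) = μ.law a
  ae_map_eq : ∀ {a b : Finset ℕ} (h : a ⊆ b), ∀ᵐ ω ∂P, D.map (inclEmb h) (ω b) = ω a

namespace IsCoherent

variable {D : BDS} {μ : ExchLaw D} {P P' : Measure D.Family}

theorem isProbabilityMeasure (hP : IsCoherent μ P) : IsProbabilityMeasure P := by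
  have := μ.prob ∅
  rw [← hP.map_eval ∅] at this
  exact Measure.isProbabilityMeasure_of_map (f := fun ω : D.Family => ω ∅)

theorem map_restrict (hP : IsCoherent μ P) (I : Finset (Finset ℕ)) :
    P.map I.restrict = (μ.law (I.sup id)).map
      fun x (a : I) => D.map (inclEmb (Finset.le_sup (f := id) a.2)) x := by
  have hm : Measurable fun (x : D.obj (I.sup id)) (a : I) =>
      D.map (inclEmb (Finset.le_sup (f := id) a.2)) x :=
    measurable_pi_lambda _ fun a => D.map_measurable _
  rw [← hP.map_eval, Measure.map_map hm (measurable_pi_apply _)]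
  refine Measure.map_congr ?_
  have : ∀ᵐ ω ∂P, ∀ a : I,
      D.map (inclEmb (Finset.le_sup (f := id) a.2)) (ω (I.sup id)) = ω a :=
    ae_all_iff.2 fun a => hP.ae_map_eq _
  filter_upwards [this] with ω hω
  funext a
  exact (hω a).symm

theorem unique (hP : IsCoherent μ P) (hP' : IsCoherent μ P') : P = P' := by
  have := hP'.isProbabilityMeasure
  have h' : IsProjectiveLimit P' fun I => P'.map I.restrict := fun I => rfl
  have h : IsProjectiveLimit P fun I => P'.map I.restrict := fun I => by
    rw [hP.map_restrict]
    exact (hP'.map_restrict I).symm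
  have (I : Finset (Finset ℕ)) : IsFiniteMeasure (P'.map I.restrict) :=
    inferInstance
  exact h.unique h'

theorem map_shift_isCoherent (hP : IsCoherent μ P) (φ : ℕ ↪ ℕ) :
    IsCoherent μ (P.map (D.shift φ)) where
  map_eval a := by
    rw [Measure.map_map (measurable_pi_apply a) (BDS.measurable_shift φ), ← μ.exch (BDS.embOn φ a),
      ← hP.map_eval, Measure.map_map (D.map_measurable _) (measurable_pi_apply _)]
    rfl
  ae_map_eq {a b} h := by
    refine (ae_map_iff (BDS.measurable_shift φ).aemeasurable (measurableSet_eq_fun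
      ((D.map_measurable _).comp (measurable_pi_apply _)) (measurable_pi_apply _))).2 ?_
    filter_upwards [hP.ae_map_eq (Finset.map_subset_map.2 h : a.map φ ⊆ b.map φ)] with ω hω
    simp only [Function.comp_apply, BDS.shift, BDS.map_map_apply]
    rw [← hω, BDS.map_map_apply]
    rfl

theorem measurePreserving_shift (hP : IsCoherent μ P) (φ : ℕ ↪ ℕ) :
    MeasurePreserving (D.shift φ) P P :=
  ⟨BDS.measurable_shift φ, (hP.map_shift_isCoherent φ).unique hP⟩

end IsCoherent

theorem exists_ae_compatible_sequence {D : BDS} (μ : ExchLaw D) :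
    ∃ X : ∀ n : ℕ, (ℕ → ℝ) → D.obj (Finset.range n), (∀ n, Measurable (X n)) ∧
      (∀ n, (Measure.infinitePi fun _ : ℕ => unifMeas).map (X n) = μ.law (Finset.range n)) ∧
      ∀ n, ∀ᵐ u ∂(Measure.infinitePi fun _ : ℕ => unifMeas),
        D.map (inclEmb (Finset.range_subset_range.2 n.le_succ)) (X (n + 1) u) = X n u := by
  have hprob := μ.prob
  have hne : ∀ a, Nonempty (D.obj a) := fun a => (μ.law a).nonempty_of_neZero
  let i (n : ℕ) := inclEmb (Finset.range_subset_range.2 n.le_succ)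
  have hi (n : ℕ) : Measurable (D.map (i n)) := D.map_measurable (i n)
  obtain ⟨f₀, hf₀, hf₀μ⟩ := exists_measurable_map_unifMeas_eq
    (Kernel.const Unit (μ.law (Finset.range 0)))
  choose f hf hfκ using fun n => exists_measurable_map_unifMeas_eq
    (condDistrib id (D.map (i n)) (μ.law (Finset.range (n + 1))))
  let X : ∀ n : ℕ, (ℕ → ℝ) → D.obj (Finset.range n) := fun n => Nat.rec
    (fun u => f₀ () (u 0)) (fun n x u => f n (x u) (u (n + 1))) n
  have hXs : ∀ n, X (n + 1) = fun u => f n (X n u) (u (n + 1)) := fun n => rfl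
  have hXm : ∀ n, Measurable (X n) := by
    intro n
    induction n with
    | zero => exact hf₀.comp (measurable_const.prodMk (measurable_pi_apply 0))
    | succ n ih =>
      rw [hXs]
      exact (hf n).comp (ih.prodMk (measurable_pi_apply _))
  have hXloc : ∀ n m u x, n < m → X n (Function.update u m x) = X n u := by
    intro n m u x hnm
    induction n with
    | zero =>
      change f₀ () _ = f₀ () _
      rw [Function.update_of_ne (by omega)]
    | succ n ih =>
      simp only [hXs]
      rw [ih (by omega), Function.update_of_ne (by omega)]
  have hstep : ∀ n, (Measure.infinitePi fun _ : ℕ => unifMeas).map (X n) =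
      μ.law (Finset.range n) → (Measure.infinitePi fun _ : ℕ => unifMeas).map
        (fun u => (X n u, X (n + 1) u)) =
      (μ.law (Finset.range (n + 1))).map fun x => (D.map (i n) x, x) := by
    intro n hn
    rw [hXs]
    simp only
    rw [map_prodMk_isolated (hXm n) (n + 1) (fun u x => hXloc n _ u x (by omega)) _ (hf n)
      (hfκ n), hn, ← μ.exch (i n)]
    exact compProd_map_condDistrib aemeasurable_id
  have hXlaw : ∀ n, (Measure.infinitePi fun _ : ℕ => unifMeas).map (X n) =
      μ.law (Finset.range n) := by
    intro n
    induction n with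
    | zero =>
      have h1 : Measurable (f₀ ()) := hf₀.comp measurable_prodMk_left
      have h2 : X 0 = f₀ () ∘ fun u => u 0 := rfl
      rw [h2, ← Measure.map_map h1 (measurable_pi_apply 0), Measure.infinitePi_map_eval, hf₀μ]
      rfl
    | succ n ih =>
      have h := congrArg (Measure.map Prod.snd) (hstep n ih)
      exact (Measure.map_map measurable_snd ((hXm n).prodMk (hXm (n + 1)))).symm.trans (h.trans
        ((Measure.map_map measurable_snd ((hi n).prodMk measurable_id)).trans Measure.map_id))
  refine ⟨X, hXm, hXlaw, fun n => ?_⟩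
  have hs : MeasurableSet {p : D.obj (Finset.range n) × D.obj (Finset.range (n + 1)) |
      D.map (i n) p.2 = p.1} := measurableSet_eq_fun ((hi n).comp measurable_snd) measurable_fst
  have h : ∀ᵐ p ∂(Measure.infinitePi fun _ : ℕ => unifMeas).map (fun u => (X n u, X (n + 1) u)),
      D.map (i n) p.2 = p.1 := by
    rw [hstep n (hXlaw n)]
    exact (ae_map_iff ((hi n).prodMk measurable_id).aemeasurable hs).2
      (Filter.Eventually.of_forall fun x => rfl)
  exact ae_of_ae_map ((hXm n).prodMk (hXm (n + 1))).aemeasurable h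

theorem exists_isCoherent {D : BDS} (μ : ExchLaw D) : ∃ P, IsCoherent μ P := by
  obtain ⟨X, hXm, hXlaw, hX⟩ := exists_ae_compatible_sequence μ
  have hle : ∀ {m n : ℕ} (h : m ≤ n), ∀ᵐ u ∂(Measure.infinitePi fun _ : ℕ => unifMeas),
      D.map (inclEmb (Finset.range_subset_range.2 h)) (X n u) = X m u := by
    intro m n h
    induction n, h using Nat.le_induction with
    | base =>
      refine Filter.Eventually.of_forall fun u => ?_
      exact congrFun (D.map_id _) _
    | succ n h ih =>
      filter_upwards [ih, hX n] with u h1 h2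
      rw [← h1, ← h2, BDS.map_map_apply]
      rfl
  have hsub : ∀ a : Finset ℕ, a ⊆ Finset.range (a.sup id + 1) := fun a i hi => by
    have : i ≤ a.sup id := Finset.le_sup (f := id) hi
    simpa [Nat.lt_succ_iff] using this
  let F : (ℕ → ℝ) → D.Family := fun u a => D.map (inclEmb (hsub a)) (X _ u)
  have hF : Measurable F := measurable_pi_lambda _ fun a => (D.map_measurable _).comp (hXm _)
  refine ⟨(Measure.infinitePi fun _ : ℕ => unifMeas).map F, fun a => ?_, fun {a b} h => ?_⟩
  · rw [Measure.map_map (measurable_pi_apply a) hF, ← μ.exch (inclEmb (hsub a)), ← hXlaw,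
      Measure.map_map (D.map_measurable _) (hXm _)]
    rfl
  · refine (ae_map_iff hF.aemeasurable (measurableSet_eq_fun
      ((D.map_measurable _).comp (measurable_pi_apply _)) (measurable_pi_apply _))).2 ?_
    have hab : a.sup id + 1 ≤ b.sup id + 1 := Nat.succ_le_succ (Finset.sup_mono h)
    filter_upwards [hle hab] with u hu
    simp only [Function.comp_apply, F, BDS.map_map_apply]
    rw [← hu, BDS.map_map_apply]
    rfl

section Assembly

open Finset

variable {S : Type*} [Nonempty S]

/-- The values of `w` at the images under `f` of the proper subsets of `{0, …, n - 1}`. -/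
noncomputable def boundary (n : ℕ) (f : ℕ ↪ ℕ) (w : Finset ℕ → S) (s : Finset ℕ) : S :=
  if s ⊂ range n then w (s.map f) else Classical.arbitrary S

/-- The values of `w` on `B`. -/
noncomputable def cut (B : Finset (Finset ℕ)) (w : Finset ℕ → S) (b : Finset ℕ) : S :=
  if b ∈ B then w b else Classical.arbitrary S

theorem boundary_congr {n : ℕ} {f : ℕ ↪ ℕ} {w w' : Finset ℕ → S}
    (h : ∀ s ⊂ range n, w (s.map f) = w' (s.map f)) : boundary n f w = boundary n f w' := by
  funext s
  simp only [boundary]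
  split_ifs with hs
  · exact h s hs
  · rfl

theorem boundary_cut {c : Finset ℕ} {B : Finset (Finset ℕ)} (hB : ∀ b ⊂ c, b ∈ B)
    (w : Finset ℕ → S) :
    boundary c.card (enum c).toEmbedding (cut B w) =
      boundary c.card (enum c).toEmbedding w :=
  boundary_congr fun _ hs => if_pos (hB _ (map_enum_ssubset hs))

theorem cut_eq_update (B : Finset (Finset ℕ)) {c : Finset ℕ} (hc : c ∈ B) (w : Finset ℕ → S) :
    cut B w = Function.update (cut (B.erase c) w) c (w c) := by
  funext b
  by_cases h : b = c
  · subst h; simp [cut, hc]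
  · simp [cut, h]

/-- The recursive construction that computes the value at `c` from those at the proper subsets
of `c` and the noise variable of `c`. -/
noncomputable def assemble (h : ℕ → (Finset ℕ → S) → ℝ → S) (u : Finset ℕ → ℝ)
    (c : Finset ℕ) : S :=
  h c.card (fun s => if _hs : s ⊂ range c.card then
    assemble h u (s.map (enum c).toEmbedding) else Classical.arbitrary S) (u c)
termination_by c.card
decreasing_by simpa using card_lt_card _hs

variable {h : ℕ → (Finset ℕ → S) → ℝ → S}

theorem assemble_eq (u : Finset ℕ → ℝ) (c : Finset ℕ) :
    assemble h u c = h c.card (boundary c.card (enum c).toEmbedding (assemble h u)) (u c) := by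
  rw [assemble]
  rfl

theorem assemble_congr {u u' : Finset ℕ → ℝ} {c : Finset ℕ} (huu' : ∀ s ⊆ c, u s = u' s) :
    assemble h u c = assemble h u' c := by
  induction hn : c.card using Nat.strong_induction_on generalizing c with
  | _ n ih =>
    subst hn
    rw [assemble_eq, assemble_eq, huu' c subset_rfl]
    congr 1
    refine boundary_congr fun s hs => ?_
    have hsc := map_enum_ssubset hs
    exact ih _ (card_lt_card hsc) (fun t ht => huu' t (ht.trans hsc.subset)) rfl

theorem assemble_map (f : ℕ ↪o ℕ) (u : Finset ℕ → ℝ) (c : Finset ℕ) :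
    assemble h u (c.map f.toEmbedding) = assemble h (fun s => u (s.map f.toEmbedding)) c := by
  induction hn : c.card using Nat.strong_induction_on generalizing c with
  | _ n ih =>
    subst hn
    rw [assemble_eq, assemble_eq, card_map]
    congr 1
    funext s
    simp only [boundary]
    split_ifs with hs
    · rw [← ih _ (card_lt_card (map_enum_ssubset hs)) _ rfl, map_map]
      congr 1
      refine map_congr_of_eqOn fun i hi => ?_
      exact enum_map f c (mem_range.1 (hs.subset hi))
    · rfl

variable [MeasurableSpace S]

theorem measurable_boundary (n : ℕ) (f : ℕ ↪ ℕ) : Measurable (boundary (S := S) n f) := by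
  refine measurable_pi_lambda _ fun s => ?_
  by_cases hs : s ⊂ range n
  · simpa [boundary, hs] using measurable_pi_apply _
  · simp [boundary, hs]

theorem measurable_cut (B : Finset (Finset ℕ)) : Measurable (cut (S := S) B) := by
  refine measurable_pi_lambda _ fun b => ?_
  by_cases hb : b ∈ B
  · simpa [cut, hb] using measurable_pi_apply _
  · simp [cut, hb]

theorem measurable_assemble (hh : ∀ n, Measurable (Function.uncurry (h n))) (c : Finset ℕ) :
    Measurable fun u => assemble h u c := by
  induction hn : c.card using Nat.strong_induction_on generalizing c with
  | _ n ih =>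
    subst hn
    simp_rw [assemble_eq _ c]
    refine (hh _).comp (Measurable.prodMk (measurable_pi_lambda _ fun s => ?_)
      (measurable_pi_apply c))
    change Measurable fun u => boundary c.card (enum c).toEmbedding (assemble h u) s
    by_cases hs : s ⊂ range c.card
    · simpa [boundary, hs] using ih _ (card_lt_card (map_enum_ssubset hs)) _ rfl
    · simp [boundary, hs]

end Assembly

section Views

open Finset

variable {D : BDS} {μ : ExchLaw D} {P : Measure D.Family}

/-- The part of the family indexed by the subsets of `{2 * i | i ∈ b} ∪ {odd numbers}`,
relabelled so that it is indexed by all finite sets. -/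
noncomputable def BDS.view (ω : D.Family) (b : Finset ℕ) : D.Family := D.shift (evenOdd b) ω

theorem BDS.measurable_view : Measurable (BDS.view (D := D)) :=
  measurable_pi_lambda _ fun _ => BDS.measurable_shift _

theorem BDS.view_map (f : ℕ ↪o ℕ) (ω : D.Family) (s : Finset ℕ) :
    BDS.view ω (s.map f.toEmbedding) = BDS.view (D.shift (liftEven f.toEmbedding) ω) s := by
  rw [BDS.view, evenOdd_map, BDS.shift_trans]
  rfl

variable [Nonempty D.Family] [IsProbabilityMeasure P]

/-- The conditional law of the view at `{0, …, n - 1}` given the views at its proper subsets. -/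
noncomputable def viewKernel (P : Measure D.Family) [IsProbabilityMeasure P] (n : ℕ) :
    Kernel (Finset ℕ → D.Family) D.Family :=
  condDistrib (fun ω => BDS.view ω (range n))
    (fun ω => boundary n (Function.Embedding.refl ℕ) (BDS.view ω)) P

instance (n : ℕ) : IsMarkovKernel (viewKernel P n) := by
  unfold viewKernel; infer_instance

theorem map_boundary_view (hP : IsCoherent μ P) (c : Finset ℕ) :
    P.map (fun ω => (boundary c.card (enum c).toEmbedding (BDS.view ω), BDS.view ω c)) =
      P.map (fun ω => boundary c.card (enum c).toEmbedding (BDS.view ω)) ⊗ₘ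
        viewKernel P c.card := by
  set T := D.shift (liftEven (enum c).toEmbedding) with hT
  have hTP : MeasurePreserving T P P := hP.measurePreserving_shift _
  have hb : ∀ ω, boundary c.card (enum c).toEmbedding (BDS.view ω) =
      boundary c.card (Function.Embedding.refl ℕ) (BDS.view (T ω)) := fun ω => by
    funext s
    simp only [boundary, BDS.view_map, map_refl, hT]
  have hv : ∀ ω, BDS.view ω c = BDS.view (T ω) (range c.card) := fun ω => by
    conv_lhs => rw [← map_enum c]
    rw [BDS.view_map]
  have hm1 : Measurable fun ω : D.Family =>
      boundary c.card (Function.Embedding.refl ℕ) (BDS.view ω) :=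
    (measurable_boundary _ _).comp BDS.measurable_view
  have hm2 : Measurable fun ω : D.Family => BDS.view ω (range c.card) :=
    (measurable_pi_apply _).comp BDS.measurable_view
  simp_rw [hb, hv]
  have h1 := Measure.map_map (hm1.prodMk hm2) hTP.measurable (μ := P)
  have h2 := Measure.map_map hm1 hTP.measurable (μ := P)
  rw [hTP.map_eq] at h1 h2
  refine h1.symm.trans (Eq.trans ?_ (congrArg (· ⊗ₘ _) h2))
  exact (compProd_map_condDistrib hm2.aemeasurable).symm

/-- The view at `c` is conditionally independent of the views at sets not containing `c`, given
the views at the proper subsets of `c`. -/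
theorem map_cut_view (hP : IsCoherent μ P) {B : Finset (Finset ℕ)} {c : Finset ℕ}
    (hBc : ∀ b ∈ B, ¬ c ⊆ b) (hcB : ∀ b ⊂ c, b ∈ B) :
    P.map (fun ω => (cut B (BDS.view ω), BDS.view ω c)) =
      P.map (fun ω => cut B (BDS.view ω)) ⊗ₘ (viewKernel P c.card).comap
        (boundary c.card (enum c).toEmbedding) (measurable_boundary _ _) := by
  have hk : P.map (fun ω => (boundary c.card (enum c).toEmbedding (cut B (BDS.view ω)),
      BDS.view ω c)) = P.map (fun ω => boundary c.card (enum c).toEmbedding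
        (cut B (BDS.view ω))) ⊗ₘ viewKernel P c.card := by
    simpa only [boundary_cut hcB] using map_boundary_view hP c
  refine map_prodMk_eq_compProd_comap ((measurable_pi_apply _).comp BDS.measurable_view)
    ((measurable_cut B).comp BDS.measurable_view) (measurable_boundary _ _) _ hk
    (measurableCylinders fun a => D.obj a) generateFrom_measurableCylinders.symm
    isPiSystem_measurableCylinders fun A hA => ?_
  obtain ⟨I, A, -, rfl⟩ := (mem_measurableCylinders _).1 hA
  set M := (I.sup id).sup id + 1
  choose χ hχ using fun b => exists_trans_absorb b c M
  have hs : ∀ b ∈ B, ∃ s ⊂ range c.card, s.map (enum c).toEmbedding = b ∩ c := by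
    intro b hb
    have hbc : b ∩ c ⊂ c := inter_subset_right.ssubset_of_ne fun h =>
      hBc b hb (h ▸ inter_subset_left)
    obtain ⟨s, hs, hsb⟩ := subset_map_iff.1 ((map_enum c).symm ▸ hbc.subset :
      b ∩ c ⊆ (range c.card).map (enum c).toEmbedding)
    refine ⟨s, hs.ssubset_of_ne ?_, hsb.symm⟩
    rintro rfl
    exact hbc.ne (hsb.trans (map_enum c))
  choose! s hsc hsb using hs
  refine ⟨D.shift (absorb c M), fun z => cut B fun b => D.shift (χ b) (z (s b)),
    hP.measurePreserving_shift _, ?_, fun ω => ?_, ?_⟩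
  · exact (measurable_cut B).comp (measurable_pi_lambda _ fun b =>
      (BDS.measurable_shift _).comp (measurable_pi_apply _))
  · funext b
    by_cases hb : b ∈ B
    · simp only [Function.comp_apply]
      rw [boundary_cut hcB]
      simp only [cut, hb, if_true, boundary, hsc b hb, hsb b hb]
      rw [BDS.view, BDS.view, ← BDS.shift_trans, hχ, BDS.shift_trans]
    · simp [cut, hb]
  · ext ω
    have : I.restrict (BDS.view (D.shift (absorb c M) ω) c) = I.restrict (BDS.view ω c) := by
      funext a
      simp only [Finset.restrict, BDS.view]
      rw [← BDS.shift_trans]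
      refine BDS.shift_apply_congr (fun i hi => absorb_evenOdd c ?_) ω
      have h1 : i ≤ (I.sup id).sup id :=
        le_sup (f := id) ((le_sup (f := id) a.2 : (a : Finset ℕ) ≤ I.sup id) hi)
      omega
    simp only [Set.mem_preimage, mem_cylinder, this, Function.comp_apply]

theorem map_cut_assemble (hP : IsCoherent μ P) {h : ℕ → (Finset ℕ → D.Family) → ℝ → D.Family}
    (hh : ∀ n, Measurable (Function.uncurry (h n)))
    (hhP : ∀ n w, unifMeas.map (h n w) = viewKernel P n w) (B : Finset (Finset ℕ))
    (hB : ∀ c ∈ B, ∀ b ⊆ c, b ∈ B) :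
    (Measure.infinitePi fun _ : Finset ℕ => unifMeas).map (fun u => cut B (assemble h u)) =
      P.map fun ω => cut B (BDS.view ω) := by
  induction hn : B.card generalizing B with
  | zero =>
    obtain rfl := card_eq_zero.1 hn
    have : ∀ w : Finset ℕ → D.Family, cut ∅ w = fun _ => Classical.arbitrary _ := fun w => rfl
    simp_rw [this, Measure.map_const]
    simp
  | succ n ih =>
    obtain ⟨c, hc, hmax⟩ := B.exists_max_image card (card_pos.1 (by omega))
    have hBc : ∀ b ∈ B.erase c, ¬ c ⊆ b := fun b hb hcb =>
      (mem_erase.1 hb).1 (eq_of_subset_of_card_le hcb (hmax b (mem_erase.1 hb).2)).symm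
    have hcB : ∀ b ⊂ c, b ∈ B.erase c := fun b hb =>
      mem_erase.2 ⟨hb.ne, hB c hc b hb.subset⟩
    have ih' := ih (B.erase c) (fun d hd b hb => mem_erase.2 ⟨by
      rintro rfl; exact hBc d hd hb, hB d (mem_erase.1 hd).2 b hb⟩) (by
      rw [card_erase_of_mem hc]; omega)
    have hga : Measurable fun u => assemble h u :=
      measurable_pi_lambda _ fun c => measurable_assemble hh c
    have hW := (measurable_cut (B.erase c)).comp hga
    have hq := measurable_boundary (S := D.Family) c.card (enum c).toEmbedding
    have hloc : ∀ (u : Finset ℕ → ℝ) x, cut (B.erase c) (assemble h (Function.update u c x)) =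
        cut (B.erase c) (assemble h u) := fun u x => by
      funext b
      simp only [cut]
      split_ifs with hb
      · refine assemble_congr fun s hs => Function.update_of_ne ?_ _ _
        rintro rfl
        exact hBc b hb hs
      · rfl
    have key := map_prodMk_isolated hW c hloc
      ((viewKernel P c.card).comap (boundary c.card (enum c).toEmbedding) hq)
      (f := fun w => h c.card (boundary c.card (enum c).toEmbedding w))
      ((hh _).comp ((hq.comp measurable_fst).prodMk measurable_snd)) fun w => hhP _ _
    have key' : (Measure.infinitePi fun _ : Finset ℕ => unifMeas).map
        (fun u => (cut (B.erase c) (assemble h u), assemble h u c)) =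
        P.map fun ω => (cut (B.erase c) (BDS.view ω), BDS.view ω c) := by
      rw [map_cut_view hP hBc hcB, ← ih', ← Function.comp_def (cut (B.erase c)), ← key]
      congr 1
      funext u
      simp only [Function.comp_apply]
      rw [boundary_cut hcB, assemble_eq u c]
    simp_rw [cut_eq_update B hc]
    have hu := measurable_update_prod (S := D.Family) c
    have h1 := Measure.map_map hu (hW.prodMk (measurable_assemble hh c))
      (μ := Measure.infinitePi fun _ : Finset ℕ => unifMeas)
    have h2 := Measure.map_map hu (((measurable_cut (B.erase c)).comp BDS.measurable_view).prodMk
      ((measurable_pi_apply c).comp BDS.measurable_view)) (μ := P)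
    exact h1.symm.trans ((congrArg _ key').trans h2)

end Views

section Representation

open Finset

variable {D : BDS} {μ : ExchLaw D}

theorem BDS.ae_map_view_eq {P : Measure D.Family} (hP : IsCoherent μ P) {m n : ℕ} (f : ℕ ↪o ℕ)
    (θ : ↥(range m) ↪ ↥(range n)) (hθ : ∀ i, (θ i : ℕ) = f i) :
    ∀ᵐ ω ∂P, D.map θ (BDS.view ω (range n) (range n)) =
      BDS.view ω ((range m).map f.toEmbedding) (range m) := by
  have hm : ∀ i < m, evenOdd ((range m).map f.toEmbedding) i = 2 * f i := fun i hi => by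
    rw [evenOdd_of_lt (by simpa using hi), enum_map _ _ (by simpa using hi), enum_range hi]
  have hn : ∀ i < n, evenOdd (range n) i = 2 * i := fun i hi => by
    rw [evenOdd_of_lt (by simpa using hi), enum_range hi]
  have hf : ∀ i < m, f i < n := fun i hi => by
    have h1 := hθ ⟨i, mem_range.2 hi⟩
    have h2 := mem_range.1 (θ ⟨i, mem_range.2 hi⟩).2
    simp only at h1
    omega
  have hsub : (range m).map (evenOdd ((range m).map f.toEmbedding)) ⊆
      (range n).map (evenOdd (range n)) := fun k hk => by
    obtain ⟨i, hi, rfl⟩ := mem_map.1 hk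
    have hi' := mem_range.1 hi
    exact mem_map.2 ⟨f i, mem_range.2 (hf i hi'), by rw [hm i hi', hn _ (hf i hi')]⟩
  filter_upwards [hP.ae_map_eq hsub] with ω hω
  simp only [BDS.view, BDS.shift]
  rw [← hω, BDS.map_map_apply, BDS.map_map_apply]
  refine BDS.map_apply_congr ω _ _ rfl fun i => ?_
  change evenOdd (range n) (θ i) = evenOdd ((range m).map f.toEmbedding) i
  rw [hn _ (mem_range.1 (θ i).2), hm _ (mem_range.1 i.2), hθ]

/-- There is a measurable functional of a uniform random array which has the prescribed marginals
and is almost surely compatible with increasing relabellings. -/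
theorem exists_ae_natural_functional (μ : ExchLaw D) :
    ∃ X : ∀ n : ℕ, (Finset ℕ → ℝ) → D.obj (range n), (∀ n, Measurable (X n)) ∧
      (∀ n u u', (∀ s ⊆ range n, u s = u' s) → X n u = X n u') ∧
      (∀ n, (Measure.infinitePi fun _ : Finset ℕ => unifMeas).map (X n) = μ.law (range n)) ∧
      ∀ (m n : ℕ) (f : ℕ ↪o ℕ) (θ : ↥(range m) ↪ ↥(range n)), (∀ i, (θ i : ℕ) = f i) →
        ∀ᵐ u ∂(Measure.infinitePi fun _ : Finset ℕ => unifMeas),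
          D.map θ (X n u) = X m fun s => u (s.map f.toEmbedding) := by
  obtain ⟨P, hP⟩ := exists_isCoherent μ
  have hprob := μ.prob
  have : ∀ a, Nonempty (D.obj a) := fun a => (μ.law a).nonempty_of_neZero
  have : Nonempty D.Family := inferInstance
  have := hP.isProbabilityMeasure
  choose h hh hhP using fun n => exists_measurable_map_unifMeas_eq (viewKernel P n)
  have key := fun n => map_cut_assemble hP hh hhP (range n).powerset
    fun c hc b hb => mem_powerset.2 (hb.trans (mem_powerset.1 hc))
  have hA : ∀ n, Measurable fun u => cut (range n).powerset (assemble h u) := fun n =>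
    (measurable_cut _).comp (measurable_pi_lambda _ (measurable_assemble hh))
  have hV : ∀ n, Measurable fun ω : D.Family => cut (range n).powerset (BDS.view ω) := fun n =>
    (measurable_cut _).comp BDS.measurable_view
  have hev : ∀ b c, Measurable fun w : Finset ℕ → D.Family => w b c := fun b c =>
    (measurable_pi_apply c).comp (measurable_pi_apply b)
  refine ⟨fun n u => assemble h u (range n) (range n),
    fun n => (measurable_pi_apply _).comp (measurable_assemble hh _),
    fun n u u' huu' => congrFun (assemble_congr huu') _, fun n => ?_, fun m n f θ hθ => ?_⟩
  · have h1 := congrArg (Measure.map fun w : Finset ℕ → D.Family => w (range n) (range n)) (key n)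
    rw [Measure.map_map (hev _ _) (hA n), Measure.map_map (hev _ _) (hV n)] at h1
    simp only [Function.comp_def, cut, mem_powerset, subset_rfl, if_true] at h1
    rw [h1, ← hP.map_eval]
    conv_rhs => rw [← (hP.measurePreserving_shift (evenOdd (range n))).map_eq]
    rw [Measure.map_map (measurable_pi_apply _) (BDS.measurable_shift _)]
    rfl
  · have hsub : (range m).map f.toEmbedding ⊆ range n := fun k hk => by
      obtain ⟨i, hi, rfl⟩ := mem_map.1 hk
      exact (hθ ⟨i, hi⟩) ▸ (θ ⟨i, hi⟩).2
    have hms : MeasurableSet {w : Finset ℕ → D.Family | D.map θ (w (range n) (range n)) =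
        w ((range m).map f.toEmbedding) (range m)} :=
      measurableSet_eq_fun ((D.map_measurable θ).comp (hev _ _)) (hev _ _)
    have h1 : ∀ᵐ w ∂(P.map fun ω => cut (range n).powerset (BDS.view ω)),
        D.map θ (w (range n) (range n)) = w ((range m).map f.toEmbedding) (range m) := by
      rw [ae_map_iff (hV n).aemeasurable hms]
      filter_upwards [BDS.ae_map_view_eq hP f θ hθ] with ω hω
      simpa only [cut, mem_powerset, subset_rfl, hsub, if_true] using hω
    rw [← key, ae_map_iff (hA n).aemeasurable hms] at h1
    filter_upwards [h1] with u hu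
    simpa only [cut, mem_powerset, subset_rfl, hsub, if_true, assemble_map] using hu

theorem exists_orderEmbedding_extension {m n : ℕ} (θ : ↥(range m) ↪ ↥(range n))
    (hθ : StrictMono θ) : ∃ f : ℕ ↪o ℕ, ∀ i, (θ i : ℕ) = f i := by
  let f : ℕ → ℕ := fun i => if h : i ∈ range m then θ ⟨i, h⟩ else n + i
  have hf : StrictMono f := by
    intro i j hij
    simp only [f]
    split_ifs with h1 h2 h2
    · exact hθ hij
    · have := mem_range.1 (θ ⟨i, h1⟩).2
      omega
    · simp only [mem_range] at h1 h2
      omega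
    · omega
  exact ⟨OrderEmbedding.ofStrictMono f hf, fun i => by
    change (θ i : ℕ) = f i
    simp only [f, i.2, dif_pos]⟩

/-- An embedding of `a` into an initial segment of `ℕ` which turns the relation `r` into `<`, if
there is one. -/
@[irreducible]
noncomputable def sortEmb {a : Finset ℕ} (r : ↥a → ↥a → Prop) : ↥a ↪ ↥(range a.card) :=
  open Classical in
  if h : ∃ σ : ↥a ↪ ↥(range a.card), ∀ i j, r i j ↔ σ i < σ j then h.choose
  else (equivOfCardEq (card_range a.card).symm).toEmbedding

theorem sortEmb_spec {a : Finset ℕ} {v : ↥a → ℝ} (hv : Function.Injective v) (i j : ↥a) :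
    v i < v j ↔ sortEmb (fun i j => v i < v j) i < sortEmb (fun i j => v i < v j) j := by
  have h : ∃ σ : ↥a ↪ ↥(range a.card), ∀ i j, v i < v j ↔ σ i < σ j := by
    let S : ↥a → Finset ↥a := fun i => univ.filter fun j => v j < v i
    have hS : ∀ i, (S i).card < a.card := fun i => by
      have := card_lt_univ_of_notMem (s := S i) (x := i) (by simp [S])
      simpa using this
    have hlt : ∀ i j, v i < v j → (S i).card < (S j).card := fun i j hij =>
      card_lt_card ((ssubset_iff_of_subset fun k hk => by
        simp only [S, mem_filter_univ] at hk ⊢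
        exact hk.trans hij).2 ⟨i, by simpa [S] using hij, by simp [S]⟩)
    have hiff : ∀ i j, v i < v j ↔ (S i).card < (S j).card := fun i j => by
      refine ⟨hlt i j, fun h => ?_⟩
      by_contra! hle
      rcases hle.lt_or_eq with h' | h'
      · exact absurd (hlt j i h') (by omega)
      · rw [hv h'] at h
        omega
    refine ⟨⟨fun i => ⟨(S i).card, mem_range.2 (hS i)⟩, fun i j hij => hv ?_⟩, hiff⟩
    simp only [Subtype.mk.injEq] at hij
    exact le_antisymm (not_lt.1 fun h => by have := hlt _ _ h; omega)
      (not_lt.1 fun h => by have := hlt _ _ h; omega)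
  rw [sortEmb, dif_pos h]
  exact h.choose_spec i j

/-- Transport of an array indexed by the subsets of `a` to one indexed by finite subsets of `ℕ`. -/
def transport {a : Finset ℕ} {n : ℕ} (σ : ↥a ↪ ↥(range n)) (y : Finset ↥a → ℝ) (t : Finset ℕ) : ℝ :=
  y (univ.filter fun i => (σ i : ℕ) ∈ t)

theorem measurable_transport {a : Finset ℕ} {n : ℕ} (σ : ↥a ↪ ↥(range n)) :
    Measurable (transport σ) :=
  measurable_pi_lambda _ fun _ => measurable_pi_apply _

theorem exists_preimage {a : Finset ℕ} (σ : ↥a ↪ ↥(range a.card)) {k : ℕ} (hk : k < a.card) :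
    ∃ i, (σ i : ℕ) = k := by
  have hσ : Function.Surjective σ :=
    ((Fintype.bijective_iff_injective_and_card σ).2 ⟨σ.injective, by simp⟩).2
  obtain ⟨i, hi⟩ := hσ ⟨k, mem_range.2 hk⟩
  exact ⟨i, by rw [hi]⟩

theorem transport_map {a : Finset ℕ} (σ : ↥a ↪ ↥(range a.card)) (u : Finset ℕ → ℝ)
    {t : Finset ℕ} (ht : t ⊆ range a.card) :
    transport σ (fun s => u (s.map (σ.trans (Function.Embedding.subtype _)))) t = u t := by
  rw [transport]
  congr 1
  ext k
  simp only [mem_map, mem_filter_univ, Function.Embedding.trans_apply,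
    Function.Embedding.subtype_apply]
  constructor
  · rintro ⟨i, hi, rfl⟩
    exact hi
  · intro hk
    obtain ⟨i, rfl⟩ := exists_preimage σ (mem_range.1 (ht hk))
    exact ⟨i, hk, rfl⟩

theorem transport_trans {a b : Finset ℕ} (τ : ↥b ↪ ↥a) (σ : ↥a ↪ ↥(range a.card))
    (σ' : ↥b ↪ ↥(range b.card)) (f : ℕ ↪ ℕ) (hf : ∀ j, (σ (τ j) : ℕ) = f (σ' j))
    (y : Finset ↥a → ℝ) {s : Finset ℕ} (hs : s ⊆ range b.card) :
    transport σ y (s.map f) = transport σ' (fun t => y (t.map τ)) s := by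
  simp only [transport]
  congr 1
  ext i
  simp only [mem_map, mem_filter_univ]
  constructor
  · rintro ⟨k, hk, hki⟩
    obtain ⟨j, rfl⟩ := exists_preimage σ' (mem_range.1 (hs hk))
    exact ⟨j, hk, σ.injective (Subtype.ext ((hf j).trans hki))⟩
  · rintro ⟨j, hj, rfl⟩
    exact ⟨_, hj, (hf j).symm⟩

theorem measurePreserving_infinitePi_comp {ι κ : Type*} [Fintype κ] (e : κ ↪ ι) :
    MeasurePreserving (fun (u : ι → ℝ) k => u (e k)) (Measure.infinitePi fun _ : ι => unifMeas)
      (Measure.pi fun _ : κ => unifMeas) := by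
  refine ⟨measurable_pi_lambda _ fun k => measurable_pi_apply _, ?_⟩
  have h := (iIndepFun_infinitePi (P := fun _ : ι => unifMeas) (X := fun _ => id)
    fun i => measurable_id).precomp e.injective
  refine ((iIndepFun_iff_map_fun_eq_pi_map fun k => (measurable_pi_apply _).aemeasurable).1
    h).trans ?_
  congr 1
  funext k
  exact (measurePreserving_eval_infinitePi _ _).map_eq

theorem ae_injective_pi {κ : Type*} [Fintype κ] :
    ∀ᵐ v ∂(Measure.pi fun _ : κ => unifMeas), Function.Injective v := by
  have h : ∀ᵐ v ∂(Measure.pi fun _ : κ => unifMeas), ∀ i j, i ≠ j → v i ≠ v j := by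
    refine ae_all_iff.2 fun i => ae_all_iff.2 fun j => ?_
    by_cases hij : i = j
    · simp [hij]
    simp only [ne_eq, hij, not_false_eq_true, forall_const]
    have hind := (iIndepFun_pi (μ := fun _ : κ => unifMeas) (X := fun _ => id)
      fun i => aemeasurable_id).indepFun hij
    have hmap := (indepFun_iff_map_prod_eq_prod_map_map (measurable_pi_apply i).aemeasurable
      (measurable_pi_apply j).aemeasurable).1 hind
    have hev : ∀ k, (Measure.pi fun _ : κ => unifMeas).map (fun v => v k) = unifMeas :=
      fun k => (measurePreserving_eval _ k).map_eq
    change (Measure.pi fun _ : κ => unifMeas).map (fun v => (v i, v j)) =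
      ((Measure.pi fun _ : κ => unifMeas).map fun v => v i).prod
        ((Measure.pi fun _ : κ => unifMeas).map fun v => v j) at hmap
    rw [hev, hev] at hmap
    have hdiag : ∀ᵐ p ∂(unifMeas.prod unifMeas), p.1 ≠ p.2 := by
      refine (Measure.ae_prod_iff_ae_ae
        (measurableSet_eq_fun measurable_fst measurable_snd).compl).2 (.of_forall fun x => ?_)
      exact ae_iff.2 (by simp)
    rw [← hmap] at hdiag
    exact ae_of_ae_map (f := fun v : κ → ℝ => (v i, v j)) (by fun_prop) hdiag
  filter_upwards [h] with v hv i j hij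
  by_contra hne
  exact hv i j hne hij

theorem exists_measurePreserving_split :
    ∃ ρ : ℝ → ℝ × ℝ, MeasurePreserving ρ unifMeas (unifMeas.prod unifMeas) := by
  obtain ⟨f, hf, hfκ⟩ := exists_measurable_map_unifMeas_eq
    (Kernel.const Unit (unifMeas.prod unifMeas))
  exact ⟨f (), hf.comp (measurable_const.prodMk measurable_id), hfκ ()⟩

theorem measurePreserving_split_pi {ρ : ℝ → ℝ × ℝ}
    (hρ : MeasurePreserving ρ unifMeas (unifMeas.prod unifMeas)) (κ : Type*) [Fintype κ] :
    MeasurePreserving (fun x : κ → ℝ => (fun k => (ρ (x k)).1, fun k => (ρ (x k)).2))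
      (Measure.pi fun _ => unifMeas)
      ((Measure.pi fun _ => unifMeas).prod (Measure.pi fun _ => unifMeas)) :=
  (measurePreserving_arrowProdEquivProdArrow ℝ ℝ κ (fun _ => unifMeas) (fun _ => unifMeas)).comp
    (measurePreserving_pi (fun _ => unifMeas) (fun _ => unifMeas.prod unifMeas) fun _ => hρ)

/-- The value at `a` of a functional `X` of arrays, after ordering the elements of `a` according to
the first of two arrays. -/
noncomputable def sortedValue (D : BDS) (X : ∀ n : ℕ, (Finset ℕ → ℝ) → D.obj (range n))
    (a : Finset ℕ) (z : (Finset ↥a → ℝ) × (Finset ↥a → ℝ)) : D.obj a :=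
  D.map (sortEmb fun i j => z.1 {i} < z.1 {j})
    (X a.card (transport (sortEmb fun i j => z.1 {i} < z.1 {j}) z.2))

variable {X : ∀ n : ℕ, (Finset ℕ → ℝ) → D.obj (range n)}

theorem measurable_map_transport (hX : ∀ n, Measurable (X n)) {a : Finset ℕ}
    (σ : ↥a ↪ ↥(range a.card)) : Measurable fun y => D.map σ (X a.card (transport σ y)) :=
  (D.map_measurable σ).comp ((hX a.card).comp (measurable_transport σ))

theorem measurable_sortedValue (hX : ∀ n, Measurable (X n)) (a : Finset ℕ) :
    Measurable (sortedValue D X a) := by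
  have h1 : Measurable fun p : (Finset ↥a → ℝ) × (↥a → ↥a → Prop) =>
      D.map (sortEmb p.2) (X a.card (transport (sortEmb p.2) p.1)) :=
    measurable_from_prod_countable_left fun r => measurable_map_transport hX (sortEmb r)
  have h2 : Measurable fun z : (Finset ↥a → ℝ) × (Finset ↥a → ℝ) =>
      (z.2, fun i j : ↥a => z.1 {i} < z.1 {j}) := by
    refine measurable_snd.prodMk (measurable_pi_lambda _ fun i => measurable_pi_lambda _ fun j => ?_)
    exact measurableSet_setOfPred.1 (measurableSet_lt
      ((measurable_pi_apply _).comp measurable_fst) ((measurable_pi_apply _).comp measurable_fst))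
  exact h1.comp h2

theorem map_sortedValue (hX : ∀ n, Measurable (X n))
    (hXloc : ∀ n u u', (∀ s ⊆ range n, u s = u' s) → X n u = X n u')
    (hXlaw : ∀ n, (Measure.infinitePi fun _ : Finset ℕ => unifMeas).map (X n) = μ.law (range n))
    (a : Finset ℕ) :
    ((Measure.pi fun _ => unifMeas).prod (Measure.pi fun _ => unifMeas)).map
      (sortedValue D X a) = μ.law a := by
  have h : ∀ σ : ↥a ↪ ↥(range a.card), (Measure.pi fun _ : Finset ↥a => unifMeas).map
      (fun y => D.map σ (X a.card (transport σ y))) = μ.law a := fun σ => by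
    rw [← μ.exch σ, ← hXlaw, Measure.map_map (D.map_measurable σ) (hX _),
      ← (measurePreserving_infinitePi_comp
        (mapEmbedding (σ.trans (Function.Embedding.subtype _))).toEmbedding).map_eq]
    refine (Measure.map_map (measurable_map_transport hX σ) (by fun_prop)).trans ?_
    congr 1
    funext u
    exact congrArg (D.map σ) (hXloc _ _ _ fun s hs => transport_map σ u hs)
  ext s hs
  rw [Measure.map_apply (measurable_sortedValue hX a) hs,
    Measure.prod_apply (measurable_sortedValue hX a hs)]
  have h' : ∀ v : Finset ↥a → ℝ, (Measure.pi fun _ : Finset ↥a => unifMeas)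
      (Prod.mk v ⁻¹' (sortedValue D X a ⁻¹' s)) = μ.law a s := fun v => by
    rw [← h (sortEmb fun i j => v {i} < v {j})]
    exact (Measure.map_apply
      (measurable_map_transport hX (sortEmb fun i j => v {i} < v {j})) hs).symm
  simp [h']

theorem ae_sortedValue_natural (hX : ∀ n, Measurable (X n))
    (hXloc : ∀ n u u', (∀ s ⊆ range n, u s = u' s) → X n u = X n u')
    (hXnat : ∀ (m n : ℕ) (f : ℕ ↪o ℕ) (θ : ↥(range m) ↪ ↥(range n)), (∀ i, (θ i : ℕ) = f i) →
        ∀ᵐ u ∂(Measure.infinitePi fun _ : Finset ℕ => unifMeas),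
          D.map θ (X n u) = X m fun s => u (s.map f.toEmbedding))
    {a b : Finset ℕ} (τ : ↥b ↪ ↥a) :
    ∀ᵐ z ∂((Measure.pi fun _ : Finset ↥a => unifMeas).prod (Measure.pi fun _ => unifMeas)),
      sortedValue D X b (fun s => z.1 (s.map τ), fun s => z.2 (s.map τ)) =
        D.map τ (sortedValue D X a z) := by
  have h1 : ∀ (θ : ↥(range b.card) ↪ ↥(range a.card)) (σ : ↥a ↪ ↥(range a.card)),
      ∀ᵐ y ∂(Measure.pi fun _ : Finset ↥a => unifMeas), ∀ f : ℕ ↪o ℕ, (∀ i, (θ i : ℕ) = f i) →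
        D.map θ (X a.card (transport σ y)) =
          X b.card fun s => transport σ y (s.map f.toEmbedding) := by
    intro θ σ
    by_cases hθ : ∃ f : ℕ ↪o ℕ, ∀ i, (θ i : ℕ) = f i
    · obtain ⟨f, hf⟩ := hθ
      have h := hXnat _ _ f θ hf
      have hg := measurePreserving_infinitePi_comp
        (mapEmbedding (σ.trans (Function.Embedding.subtype _))).toEmbedding
      have h' : ∀ᵐ y ∂(Measure.pi fun _ : Finset ↥a => unifMeas),
          D.map θ (X a.card (transport σ y)) =
            X b.card fun s => transport σ y (s.map f.toEmbedding) := by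
        rw [← hg.map_eq]
        refine (ae_map_iff hg.measurable.aemeasurable (measurableSet_eq_fun
          ((D.map_measurable θ).comp ((hX _).comp (measurable_transport σ))) ((hX _).comp
            (measurable_pi_lambda _ fun s => (measurable_pi_apply _).comp
              (measurable_transport σ))))).2 ?_
        filter_upwards [h] with u hu
        refine Eq.trans ?_ (hu.trans ?_)
        · exact congrArg (D.map θ) (hXloc _ _ _ fun s hs => transport_map σ u hs)
        · refine hXloc _ _ _ fun s hs => (transport_map σ u fun k hk => ?_).symm
          obtain ⟨i, hi, rfl⟩ := mem_map.1 hk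
          exact hf ⟨i, hs hi⟩ ▸ (θ ⟨i, hs hi⟩).2
      filter_upwards [h'] with y hy f' hf'
      rw [hy]
      refine hXloc _ _ _ fun s hs => congrArg _ (map_congr_of_eqOn fun i hi => ?_)
      exact (hf ⟨i, hs hi⟩).symm.trans (hf' ⟨i, hs hi⟩)
    · exact .of_forall fun y f hf => absurd ⟨f, hf⟩ hθ
  have hv : ∀ᵐ z ∂((Measure.pi fun _ : Finset ↥a => unifMeas).prod
      (Measure.pi fun _ : Finset ↥a => unifMeas)), Function.Injective z.1 :=
    Measure.quasiMeasurePreserving_fst.ae ae_injective_pi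
  have hw := (Measure.quasiMeasurePreserving_snd (μ := Measure.pi fun _ : Finset ↥a => unifMeas)
    (ν := Measure.pi fun _ : Finset ↥a => unifMeas)).ae
    (ae_all_iff.2 fun θ => ae_all_iff.2 fun σ => h1 θ σ)
  filter_upwards [hv, hw] with ⟨v, w⟩ hv hw
  simp only [sortedValue, map_singleton] at *
  have hs := sortEmb_spec (v := fun i => v {i}) (hv.comp singleton_injective)
  have hs' := sortEmb_spec (v := fun j => v {τ j}) (hv.comp (singleton_injective.comp τ.injective))
  set σ := sortEmb fun i j => v {i} < v {j}
  set σ' := sortEmb fun i j => v {τ i} < v {τ j}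
  have hσ' : Function.Bijective σ' :=
    (Fintype.bijective_iff_injective_and_card σ').2 ⟨σ'.injective, by simp⟩
  let e := Equiv.ofBijective σ' hσ'
  let θ : ↥(range b.card) ↪ ↥(range a.card) := e.symm.toEmbedding.trans (τ.trans σ)
  have hθσ : ∀ j, θ (σ' j) = σ (τ j) := fun j =>
    congrArg (fun i => σ (τ i)) (e.symm_apply_apply j)
  have hθ : StrictMono θ := fun p q hpq => by
    obtain ⟨i, rfl⟩ := hσ'.2 p
    obtain ⟨j, rfl⟩ := hσ'.2 q
    rw [hθσ, hθσ]
    exact (hs _ _).1 ((hs' _ _).2 hpq)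
  obtain ⟨f, hf⟩ := exists_orderEmbedding_extension θ hθ
  have hcomp : τ.trans σ = σ'.trans θ := by
    ext j
    exact congrArg Subtype.val (hθσ j).symm
  rw [BDS.map_map_apply, hcomp, ← BDS.map_map_apply, hw θ σ f hf]
  refine congrArg (D.map σ') (hXloc _ _ _ fun s hs => (transport_trans τ σ σ' f.toEmbedding
    (fun j => ?_) w hs).symm)
  rw [← hθσ]
  exact hf _

end Representation

/-- Weak functional representation theorem: every exchangeable law `μ` on a Borel
data structure `D` is the pushforward of `unif(R)` under a `unif(R)`-almost-sure
natural transformation `η : R → D`. -/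
theorem weak_functional_representation (D : BDS) (μ : ExchLaw D) :
    ∃ η : ASNatTrans RR D unifRLaw,
      ∀ a : Finset ℕ, Measure.map (η.app a) (unifRLaw a) = μ.law a := by
  obtain ⟨X, hX, hXloc, hXlaw, hXnat⟩ := exists_ae_natural_functional μ
  obtain ⟨ρ, hρ⟩ := exists_measurePreserving_split
  have hV := fun a : Finset ℕ => measurePreserving_split_pi hρ (Finset ↥a)
  refine ⟨⟨fun a x => sortedValue D X a (fun s => (ρ (x s)).1, fun s => (ρ (x s)).2),
    fun a => (measurable_sortedValue hX a).comp (hV a).measurable, fun {b a} τ =>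
    (hV a).quasiMeasurePreserving.ae (ae_sortedValue_natural hX hXloc hXnat τ)⟩, fun a => ?_⟩
  rw [← map_sortedValue hX hXloc hXlaw a, ← (hV a).map_eq,
    Measure.map_map (measurable_sortedValue hX a) (hV a).measurable]
  rfl
end
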